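/- Extended PDE system for the inner product of free developments: let 𝔶, 𝔶̃ : [0,∞) → 𝒯_0 be measurable with ∫_0^t ‖𝔶(u)‖_1 du < ∞ and ∫_0^t ‖𝔶̃(u)‖_1 du < ∞ for all t ≥ 0, and let μ, μ̃ be their free developments, i.e. μ(t) = 1 + ∫_0^t μ(u) ⊗ 𝔶(u) du and μ̃(t) = 1 + ∫_0^t μ̃(u) ⊗ 𝔶̃(u) du. Then the triplet (u, φ, φ̃) : [0,∞)² → ℝ × 𝒯^1_0 × 𝒯^1_0 given by u(s,t) = ⟨μ(s), μ̃(t)⟩, φ(s,t) = μ̃(t) ⊳₀ μ(s), φ̃(s,t) = μ(s) ⊳₀ μ̃(t) is the unique continuous solution of the coupled system: u(s,t) = 1 + ∫_0^s ∫_0^t { u(r,v)⟨𝔶(r), 𝔶̃(v)⟩ + ⟨φ(r,v), 𝔶(r) ⊲₀ 𝔶̃(v)⟩ + ⟨φ̃(r,v), 𝔶̃(v) ⊲₀ 𝔶(r)⟩ } dv dr; φ(s,t) = ∫_0^s { u(r,t) 𝔶(r) + φ(r,t) ⊗ 𝔶(r) + φ̃(r,t) ⊳₀ 𝔶(r) }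 dr; φ̃(s,t) = ∫_0^t { u(s,r) 𝔶̃(r) + φ̃(s,r) ⊗ 𝔶̃(r) + φ(s,r) ⊳₀ 𝔶̃(r) } dr, for all s, t ≥ 0. -/

import Mathlib

open scoped BigOperators ENNReal
open MeasureTheory

/-- Words of length `n` over the alphabet `{1,…,d}`: indices of a basis of `V^{⊗n}`, `V ≅ ℝ^d`. -/
abbrev Word (d n : ℕ) := Fin n → Fin d

/-- The extended tensor algebra `𝒯 = ∏_{n ≥ 0} V^{⊗n}` over `V ≅ ℝ^d`, represented by the
coefficients of tensor series in the word basis. -/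
abbrev TS (d : ℕ) := ∀ n : ℕ, Word d n → ℝ

namespace TS

variable {d : ℕ}

/-- Euclidean norm `|x^{(n)}|` of the `n`-th homogeneous component. -/
noncomputable def levelNorm (x : TS d) (n : ℕ) : ℝ :=
  Real.sqrt (∑ w : Word d n, (x n w) ^ 2)

/-- The `ℓ^p`-type norm `‖x‖_p = (∑_n |x^{(n)}|^p)^{1/p}`, valued in `[0,∞]`. -/
noncomputable def pNorm (p : ℝ) (x : TS d) : ℝ≥0∞ :=
  (∑' n : ℕ, ENNReal.ofReal (levelNorm x n) ^ p) ^ (1 / p)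

/-- The unit `1` of the tensor algebra. -/
def one : TS d := fun n _ => if n = 0 then 1 else 0

/-- The zero tensor series. -/
def zero : TS d := fun _ _ => 0

def add (x y : TS d) : TS d := fun n w => x n w + y n w

def sub (x y : TS d) : TS d := fun n w => x n w - y n w

def smul (c : ℝ) (x : TS d) : TS d := fun n w => c * x n w

/-- The (concatenation) tensor product: `(x ⊗ y)^{(n)} = ∑_{k=0}^n x^{(k)} ⊗ y^{(n-k)}`. -/
def mul (x y : TS d) : TS d := fun n w =>
  ∑ k : Fin (n + 1),
    x k.1 (fun i => w ⟨i.1, by have h1 := i.2; have h2 := k.2; omega⟩) *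
      y (n - k.1) (fun i => w ⟨k.1 + i.1, by have h1 := i.2; have h2 := k.2; omega⟩)

/-- The dual pairing `⟨x, y⟩ = ∑_n ⟨x^{(n)}, y^{(n)}⟩`. -/
noncomputable def pairing (x y : TS d) : ℝ :=
  ∑' n : ℕ, ∑ w : Word d n, x n w * y n w

/-- Projection `π_m` to the `m`-th homogeneous level. -/
def proj (m : ℕ) (x : TS d) : TS d := fun n w => if n = m then x n w else 0

/-- Truncation `π_{(0,N)}` to levels `≤ N`. -/
def truncate (N : ℕ) (x : TS d) : TS d := fun n w => if n ≤ N then x n w else 0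

/-- Removing the scalar (level-0) component. -/
def reduce (x : TS d) : TS d := fun n w => if n = 0 then 0 else x n w

/-- The dilation `δ_c`, multiplying the `n`-th level by `c^n`. -/
def dil (c : ℝ) (x : TS d) : TS d := fun n w => c ^ n * x n w

/-- The adjoint `x ⊳ z` of left tensor multiplication: `(x ⊳ z)^w = ⟨z, x ⊗ e_w⟩`. -/
noncomputable def adjL (x z : TS d) : TS d := fun n w =>
  ∑' k : ℕ, ∑ v : Word d k, x k v * z (k + n) (Fin.append v w)

/-- The adjoint `x ⊲ z` of right tensor multiplication: `(x ⊲ z)^w = ⟨z, e_w ⊗ x⟩`. -/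
noncomputable def adjR (x z : TS d) : TS d := fun n w =>
  ∑' k : ℕ, ∑ v : Word d k, x k v * z (n + k) (Fin.append w v)

/-- `S` is the free development of the (componentwise a.c.) path `γ = ∫_0^· γ'(u) du` started
at time `s`: it solves, componentwise, `S(t) = 1 + ∫_s^t S(u) ⊗ γ'(u) du`, all components of the
integrand being interval integrable. -/
def IsDev (γ' : ℝ → TS d) (s : ℝ) (S : ℝ → TS d) : Prop :=
  (∀ t n w, IntervalIntegrable (fun u => mul (S u) (γ' u) n w) volume s t) ∧
    ∀ t, s ≤ t → ∀ n w,
      S t n w = (one : TS d) n w + ∫ u in s..t, mul (S u) (γ' u) n w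

end TS

namespace TS

variable {d : ℕ}

/-- Continuity of a two-parameter `𝒯`-valued map on a set, with respect to `‖·‖_1`. -/
def Cont1On (F : ℝ → ℝ → TS d) (A : Set (ℝ × ℝ)) : Prop :=
  ∀ p ∈ A, ∀ ε : ℝ, 0 < ε → ∃ δ : ℝ, 0 < δ ∧ ∀ q ∈ A,
    dist q p < δ → pNorm 1 (sub (F q.1 q.2) (F p.1 p.2)) < ENNReal.ofReal ε

/-- The coupled Goursat-PDE/ODE system satisfied by `u(s,t) = ⟨μ(s), μ̃(t)⟩` and the adjoint
quantities `φ, φ̃`; here `reduce (adjL x z) = x ⊳₀ z` and `reduce (adjR x z) = x ⊲₀ z`. -/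
def ExtSystem (y yt : ℝ → TS d) (u : ℝ → ℝ → ℝ) (φ φt : ℝ → ℝ → TS d) : Prop :=
  (∀ s t : ℝ, 0 ≤ s → 0 ≤ t →
    u s t = 1 + ∫ r in (0:ℝ)..s, ∫ v in (0:ℝ)..t,
      (u r v * pairing (y r) (yt v)
        + pairing (φ r v) (reduce (adjR (y r) (yt v)))
        + pairing (φt r v) (reduce (adjR (yt v) (y r))))) ∧
  (∀ s t : ℝ, 0 ≤ s → 0 ≤ t → ∀ n w,
    φ s t n w = ∫ r in (0:ℝ)..s,
      (add (add (smul (u r t) (y r)) (mul (φ r t) (y r)))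
        (reduce (adjL (φt r t) (y r)))) n w) ∧
  (∀ s t : ℝ, 0 ≤ s → 0 ≤ t → ∀ n w,
    φt s t n w = ∫ r in (0:ℝ)..t,
      (add (add (smul (u s r) (yt r)) (mul (φt s r) (yt r)))
        (reduce (adjL (φ s r) (yt r)))) n w)

/-- Membership in `𝒯^1_0` and continuity requirements for a solution triplet
`(u, φ, φ̃) : [0,∞)² → ℝ × 𝒯^1_0 × 𝒯^1_0`. -/
def ExtSystemRegular (u : ℝ → ℝ → ℝ) (φ φt : ℝ → ℝ → TS d) : Prop :=
  ContinuousOn (fun p : ℝ × ℝ => u p.1 p.2) (Set.Ici 0 ×ˢ Set.Ici 0) ∧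
  Cont1On φ (Set.Ici 0 ×ˢ Set.Ici 0) ∧ Cont1On φt (Set.Ici 0 ×ˢ Set.Ici 0) ∧
  (∀ s t : ℝ, 0 ≤ s → 0 ≤ t →
    pNorm 1 (φ s t) ≠ ⊤ ∧ pNorm 1 (φt s t) ≠ ⊤ ∧
    (∀ w : Word d 0, φ s t 0 w = 0) ∧ (∀ w : Word d 0, φt s t 0 w = 0))

end TS

open scoped BigOperators ENNReal
open MeasureTheory

namespace PS
variable {d : ℕ}

/-- Euclidean vector of a level -/
noncomputable abbrev lv (x : TS d) (n : ℕ) : EuclideanSpace ℝ (Word d n) := WithLp.toLp 2 (x n)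

noncomputable def N (x : TS d) : ℝ≥0∞ := ∑' n, ‖lv x n‖ₑ

lemma levelNorm_eq (x : TS d) (n : ℕ) : TS.levelNorm x n = ‖lv x n‖ := by
  simp [TS.levelNorm, EuclideanSpace.norm_eq]

lemma pNorm_eq (x : TS d) : TS.pNorm 1 x = N x := by
  simp [TS.pNorm, N, levelNorm_eq]

lemma N_add_le (x y : TS d) : N (x + y) ≤ N x + N y := by
  rw [N, N, N, ← ENNReal.tsum_add]
  exact ENNReal.tsum_le_tsum fun n => enorm_add_le (lv x n) (lv y n)

lemma N_neg (x : TS d) : N (-x) = N x := by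
  unfold N; congr 1; ext n; exact enorm_neg (lv x n)

lemma N_sub_le (x y : TS d) : N (x - y) ≤ N x + N y := by
  rw [sub_eq_add_neg, ← N_neg y]; exact N_add_le _ _

lemma N_sub_comm (x y : TS d) : N (x - y) = N (y - x) := by
  rw [← N_neg, neg_sub]

lemma N_smul (c : ℝ) (x : TS d) : N (c • x) = ‖c‖ₑ * N x := by
  rw [N, N, ← ENNReal.tsum_mul_left]; congr 1; ext n; exact enorm_smul c (lv x n)

lemma N_zero : N (0 : TS d) = 0 := by
  simp only [N, ENNReal.tsum_eq_zero]; intro n; exact enorm_zero (E := EuclideanSpace ℝ (Word d n))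

lemma lv_le_N (x : TS d) (n : ℕ) : ‖lv x n‖ₑ ≤ N x := ENNReal.le_tsum n

lemma comp_le_lv (x : TS d) (n : ℕ) (w : Word d n) : ‖x n w‖ₑ ≤ ‖lv x n‖ₑ := by
  rw [← ofReal_norm, ← ofReal_norm]
  exact ENNReal.ofReal_le_ofReal (PiLp.norm_apply_le (lv x n) w)

lemma comp_le_N (x : TS d) (n : ℕ) (w : Word d n) : ‖x n w‖ₑ ≤ N x :=
  (comp_le_lv x n w).trans (lv_le_N x n)

lemma eq_zero_of_N (x : TS d) (h : N x = 0) : x = 0 := by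
  ext n w
  have := comp_le_N x n w
  rw [h] at this
  simpa using this

/-- monotonicity of the norm in absolute values -/
lemma lv_mono {x y : TS d} {n : ℕ} (h : ∀ w, |x n w| ≤ |y n w|) : ‖lv x n‖ₑ ≤ ‖lv y n‖ₑ := by
  rw [← ofReal_norm, ← ofReal_norm]
  apply ENNReal.ofReal_le_ofReal
  rw [EuclideanSpace.norm_eq, EuclideanSpace.norm_eq]
  apply Real.sqrt_le_sqrt
  apply Finset.sum_le_sum
  intro w _
  have := h w
  simp only [Real.norm_eq_abs]
  gcongr

lemma N_mono {x y : TS d} (h : ∀ n w, |x n w| ≤ |y n w|) : N x ≤ N y :=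
  ENNReal.tsum_le_tsum fun n => lv_mono (h n)

lemma N_one : N (TS.one : TS d) = 1 := by
  rw [N, tsum_eq_single 0]
  · rw [← ofReal_norm, EuclideanSpace.norm_eq]
    simp [TS.one]
  · intro n hn
    have : lv (TS.one : TS d) n = 0 := by ext w; simp [TS.one, hn]
    rw [this, enorm_zero]

lemma N_reduce_le (x : TS d) : N (TS.reduce x) ≤ N x := by
  apply N_mono; intro n w; unfold TS.reduce; split_ifs <;> simp

lemma N_trunc_le (M : ℕ) (x : TS d) : N (TS.truncate M x) ≤ N x := by
  apply N_mono; intro n w; unfold TS.truncate; split_ifs <;> simp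

/-- list form -/
def L (x : TS d) (l : List (Fin d)) : ℝ := x l.length l.get

def T (f : List (Fin d) → ℝ) : TS d := fun _ w => f (List.ofFn w)

lemma L_eq_aux (x : TS d) {n m : ℕ} (h : m = n) (v : Word d m) (w : Word d n)
    (hw : ∀ i : Fin m, v i = w (Fin.cast h i)) : x m v = x n w := by
  subst h
  congr 1
  ext i; simp [hw]

lemma L_ofFn (x : TS d) {n : ℕ} (w : Word d n) : L x (List.ofFn w) = x n w := by
  unfold L
  apply L_eq_aux x (by simp)
  intro i; simp; rfl

lemma T_L (x : TS d) : T (L x) = x := by ext n w; exact L_ofFn x w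

lemma L_T (f : List (Fin d) → ℝ) : L (T f) = f := by
  ext l; simp [L, T]

lemma L_T_apply (f : List (Fin d) → ℝ) (l) : L (T f) l = f l := by rw [L_T]

lemma mul_eq (x y : TS d) (n : ℕ) (w : Word d n) : TS.mul x y n w =
    ∑ k ∈ Finset.range (n + 1), L x ((List.ofFn w).take k) * L y ((List.ofFn w).drop k) := by
  rw [Finset.sum_range]
  unfold TS.mul
  apply Finset.sum_congr rfl
  intro k _
  have hk := k.2
  congr 1
  · symm; unfold L
    apply L_eq_aux x (by simp; omega)
    intro i; simp [List.getElem_take]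
  · symm; unfold L
    apply L_eq_aux y (by simp)
    intro i; simp [List.getElem_drop]

lemma L_mul (x y : TS d) (l : List (Fin d)) : L (TS.mul x y) l =
    ∑ k ∈ Finset.range (l.length + 1), L x (l.take k) * L y (l.drop k) := by
  conv_lhs => unfold L
  rw [mul_eq]; simp

/-- right shift -/
def sh (l : List (Fin d)) (z : TS d) : TS d := T fun v => L z (v ++ l)
def shR (l : List (Fin d)) (z : TS d) : TS d := T fun v => L z (l ++ v)

lemma sh_apply (z : TS d) {n k : ℕ} (w : Word d n) (v : Word d k) :
    sh (List.ofFn w) z k v = z (k + n) (Fin.append v w) := by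
  rw [← L_ofFn z, List.ofFn_fin_append]; rfl
lemma shR_apply (z : TS d) {n k : ℕ} (w : Word d n) (v : Word d k) :
    shR (List.ofFn w) z k v = z (n + k) (Fin.append w v) := by
  rw [← L_ofFn z, List.ofFn_fin_append]; rfl

lemma adjL_eq (x z : TS d) (n : ℕ) (w : Word d n) :
    TS.adjL x z n w = TS.pairing x (sh (List.ofFn w) z) := by
  simp only [TS.adjL, TS.pairing, sh_apply]
lemma adjR_eq (x z : TS d) (n : ℕ) (w : Word d n) :
    TS.adjR x z n w = TS.pairing x (shR (List.ofFn w) z) := by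
  simp only [TS.adjR, TS.pairing, shR_apply]

lemma L_adjL (x z : TS d) (l) : L (TS.adjL x z) l = TS.pairing x (sh l z) := by
  conv_lhs => unfold L
  rw [adjL_eq]; simp
lemma L_adjR (x z : TS d) (l) : L (TS.adjR x z) l = TS.pairing x (shR l z) := by
  conv_lhs => unfold L
  rw [adjR_eq]; simp

lemma L_reduce (x : TS d) (l) : L (TS.reduce x) l = if l = [] then 0 else L x l := by
  simp [L, TS.reduce]

lemma L_one (l : List (Fin d)) : L (TS.one : TS d) l = if l = [] then 1 else 0 := by
  simp [L, TS.one]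

/-- absolute value -/
def ab (x : TS d) : TS d := fun n w => |x n w|
lemma N_ab (x : TS d) : N (ab x) = N x :=
  le_antisymm (N_mono fun n w => by simp [ab]) (N_mono fun n w => by simp [ab])
lemma L_ab (x : TS d) (l) : L (ab x) l = |L x l| := rfl

lemma sum_word_add {k m : ℕ} (f : Word d (k + m) → ℝ) :
    ∑ w, f w = ∑ v : Word d k, ∑ u : Word d m, f (Fin.append v u) := by
  rw [← Fintype.sum_prod_type', ← (Fin.appendEquiv k m).sum_comp]
  rfl

/-- level pairing Cauchy-Schwarz -/
lemma lv_pair (x y : TS d) (n : ℕ) : ‖∑ w, x n w * y n w‖ₑ ≤ ‖lv x n‖ₑ * ‖lv y n‖ₑ := by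
  rw [← ofReal_norm, ← ofReal_norm, ← ofReal_norm,
    ← ENNReal.ofReal_mul (norm_nonneg _)]
  apply ENNReal.ofReal_le_ofReal
  have := norm_inner_le_norm (𝕜 := ℝ) (lv x n) (lv y n)
  simpa [PiLp.inner_apply, mul_comm] using this

lemma tsum_lv_mul (x y : TS d) : ∑' n, ‖lv x n‖ₑ * ‖lv y n‖ₑ ≤ N x * N y := by
  calc _ ≤ ∑' n, ‖lv x n‖ₑ * N y := ENNReal.tsum_le_tsum fun n => by gcongr; exact lv_le_N y n
    _ = _ := by rw [ENNReal.tsum_mul_right]; rfl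

lemma pairing_le (x y : TS d) : ‖TS.pairing x y‖ₑ ≤ N x * N y :=
  (enorm_tsum_le_tsum_enorm.trans (ENNReal.tsum_le_tsum fun n => lv_pair x y n)).trans
    (tsum_lv_mul x y)

lemma pairing_summable {x y : TS d} (hx : N x ≠ ⊤) (hy : N y ≠ ⊤) :
    Summable fun n => ∑ w, x n w * y n w := by
  apply Summable.of_enorm
  apply ne_top_of_le_ne_top (ENNReal.mul_ne_top hx hy)
  exact (ENNReal.tsum_le_tsum fun n => lv_pair x y n).trans (tsum_lv_mul x y)

lemma pairing_comm (x y : TS d) : TS.pairing x y = TS.pairing y x := by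
  simp only [TS.pairing, mul_comm]

lemma pairing_add_right {x y z : TS d} (hx : N x ≠ ⊤) (hy : N y ≠ ⊤) (hz : N z ≠ ⊤) :
    TS.pairing x (y + z) = TS.pairing x y + TS.pairing x z := by
  unfold TS.pairing
  rw [← (pairing_summable hx hy).tsum_add (pairing_summable hx hz)]
  congr 1; ext n
  rw [← Finset.sum_add_distrib]
  exact Finset.sum_congr rfl fun w _ => by simp only [Pi.add_apply]; ring

lemma pairing_smul_right (c : ℝ) (x y : TS d) :
    TS.pairing x (c • y) = c * TS.pairing x y := by
  unfold TS.pairing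
  rw [← tsum_mul_left]
  congr 1; ext n
  rw [Finset.mul_sum]
  exact Finset.sum_congr rfl fun w _ => by simp only [Pi.smul_apply, smul_eq_mul]; ring

lemma pairing_sub_right {x y z : TS d} (hx : N x ≠ ⊤) (hy : N y ≠ ⊤) (hz : N z ≠ ⊤) :
    TS.pairing x (y - z) = TS.pairing x y - TS.pairing x z := by
  have : y - z = y + (-1 : ℝ) • z := by simp [sub_eq_add_neg]
  rw [this, pairing_add_right hx hy, pairing_smul_right]; · ring
  rw [N_smul]; exact ENNReal.mul_ne_top (by simp) hz

lemma pairing_reduce (x y : TS d) : TS.pairing (TS.reduce x) y = TS.pairing x (TS.reduce y) := by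
  unfold TS.pairing TS.reduce
  congr 1; ext n; congr 1; ext w; split_ifs <;> simp

lemma pairing_one (x : TS d) : TS.pairing x TS.one = L x [] := by
  unfold TS.pairing
  rw [tsum_eq_single 0]
  · rw [Fintype.sum_unique]; simp [TS.one, L]; congr 1; exact Subsingleton.elim _ _
  · intro n hn; simp [TS.one, hn]

/-- list summability in ENNReal -/
lemma tsum_list (f : List (Fin d) → ℝ≥0∞) :
    ∑' l, f l = ∑' n, ∑ w : Word d n, f (List.ofFn w) := by
  rw [← List.equivSigmaTuple.symm.tsum_eq f, ENNReal.tsum_sigma']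
  congr 1; ext n; rw [tsum_fintype]; rfl

lemma tsum_list_le (x y : TS d) : ∑' l, ‖L x l‖ₑ * ‖L y l‖ₑ ≤ N x * N y := by
  rw [tsum_list, ← N_ab x, ← N_ab y]
  refine le_trans (ENNReal.tsum_le_tsum fun n => ?_) (tsum_lv_mul _ _)
  refine le_trans (le_of_eq ?_) (lv_pair _ _ n)
  simp only [L_ofFn, ab, ← abs_mul]
  rw [Real.enorm_of_nonneg (Finset.sum_nonneg fun _ _ => abs_nonneg _),
    ENNReal.ofReal_sum_of_nonneg fun _ _ => abs_nonneg _]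
  refine Finset.sum_congr rfl fun w _ => ?_
  rw [← enorm_mul, ← ofReal_norm, Real.norm_eq_abs]

lemma list_summable {x y : TS d} (hx : N x ≠ ⊤) (hy : N y ≠ ⊤) :
    Summable fun l => L x l * L y l := by
  apply Summable.of_enorm
  simp only [enorm_mul]
  exact ne_top_of_le_ne_top (ENNReal.mul_ne_top hx hy) (tsum_list_le x y)

lemma pairing_list {x y : TS d} (hx : N x ≠ ⊤) (hy : N y ≠ ⊤) :
    TS.pairing x y = ∑' l, L x l * L y l := by
  have hs := list_summable hx hy
  rw [← List.equivSigmaTuple.symm.tsum_eq]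
  rw [← List.equivSigmaTuple.symm.summable_iff] at hs
  change _ = ∑' c, ((fun l => L x l * L y l) ∘ List.equivSigmaTuple.symm) c
  rw [Summable.tsum_sigma' (fun n => Summable.of_finite) hs]
  unfold TS.pairing
  congr 1; ext n; rw [tsum_fintype]
  refine Finset.sum_congr rfl fun w _ => ?_
  change _ = L x (List.ofFn w) * L y (List.ofFn w)
  rw [L_ofFn, L_ofFn]

end PS
open scoped BigOperators ENNReal
open MeasureTheory

namespace PS
variable {d : ℕ}

lemma le_of_sq_le' {a b : ℝ} (h : a ^ 2 ≤ b ^ 2) (hb : 0 ≤ b) : a ≤ b := abs_le_of_sq_le_sq' h hb |>.2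

lemma enorm_abs' (a : ℝ) : ‖|a|‖ₑ = ‖a‖ₑ := by rw [← ofReal_norm, ← ofReal_norm]; simp

lemma adj_comp (n k m : ℕ) (x z : TS d) (Z : Word d k → Word d n → ℝ)
    (hZ : ∑ v, ∑ w, (Z v w) ^ 2 = ‖lv z m‖ ^ 2) :
    ‖(WithLp.toLp 2 fun w => ∑ v, x k v * Z v w : EuclideanSpace ℝ (Word d n))‖ₑ
      ≤ ‖lv x k‖ₑ * ‖lv z m‖ₑ := by
  rw [← ofReal_norm, ← ofReal_norm, ← ofReal_norm, ← ENNReal.ofReal_mul (norm_nonneg _)]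
  apply ENNReal.ofReal_le_ofReal
  refine le_of_sq_le' ?_ (by positivity)
  rw [mul_pow, ← hZ, EuclideanSpace.norm_sq_eq, EuclideanSpace.norm_sq_eq, Finset.sum_comm,
    Finset.mul_sum]
  apply Finset.sum_le_sum
  intro w _
  simp only [Real.norm_eq_abs, sq_abs]
  exact Finset.sum_mul_sq_le_sq_mul_sq _ _ _

lemma adj_aux (n : ℕ) (x z : TS d) (Z : ∀ k, Word d k → Word d n → ℝ) (m : ℕ → ℕ)
    (hZ : ∀ k, ∑ v, ∑ w, (Z k v w) ^ 2 = ‖lv z (m k)‖ ^ 2) (hx : N x ≠ ⊤) (hz : N z ≠ ⊤) :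
    ‖(WithLp.toLp 2 fun w => ∑' k, ∑ v, x k v * Z k v w : EuclideanSpace ℝ (Word d n))‖ₑ
      ≤ ∑' k, ‖lv x k‖ₑ * ‖lv z (m k)‖ₑ := by
  have hb : ∑' k, ‖lv x k‖ₑ * ‖lv z (m k)‖ₑ ≠ ⊤ := by
    apply ne_top_of_le_ne_top (ENNReal.mul_ne_top hx hz)
    calc _ ≤ ∑' n, ‖lv x n‖ₑ * N z := ENNReal.tsum_le_tsum fun n => by gcongr; exact lv_le_N z _
      _ = _ := by rw [ENNReal.tsum_mul_right]; rfl
  let A : ∀ k, EuclideanSpace ℝ (Word d n) := fun k => WithLp.toLp 2 fun w => ∑ v, x k v * Z k v w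
  have hA : ∀ k, ‖A k‖ₑ ≤ ‖lv x k‖ₑ * ‖lv z (m k)‖ₑ := fun k => adj_comp n k _ x z _ (hZ k)
  have hs : Summable A := by
    apply Summable.of_enorm
    exact ne_top_of_le_ne_top hb (ENNReal.tsum_le_tsum hA)
  have : (WithLp.toLp 2 fun w => ∑' k, ∑ v, x k v * Z k v w : EuclideanSpace ℝ (Word d n))
      = ∑' k, A k := by
    ext w
    have := (EuclideanSpace.proj (𝕜 := ℝ) w).hasSum hs.hasSum
    exact this.tsum_eq
  rw [this]
  exact enorm_tsum_le_tsum_enorm.trans (ENNReal.tsum_le_tsum hA)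

lemma adj_sum (x z : TS d) : ∑' n, ∑' k, ‖lv x k‖ₑ * ‖lv z (k + n)‖ₑ ≤ N x * N z := by
  rw [ENNReal.tsum_comm]
  calc _ ≤ ∑' k, ‖lv x k‖ₑ * N z := by
        refine ENNReal.tsum_le_tsum fun k => ?_
        rw [ENNReal.tsum_mul_left]
        gcongr
        exact ENNReal.tsum_comp_le_tsum_of_injective (add_right_injective k) (fun n => ‖lv z n‖ₑ)
    _ = _ := by rw [ENNReal.tsum_mul_right]; rfl

lemma N_adjL_le {x z : TS d} (hx : N x ≠ ⊤) (hz : N z ≠ ⊤) : N (TS.adjL x z) ≤ N x * N z := by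
  refine le_trans (ENNReal.tsum_le_tsum fun n => ?_) (adj_sum x z)
  refine adj_aux n x z (fun k v w => z (k + n) (Fin.append v w)) (fun k => k + n) (fun k => ?_) hx hz
  rw [EuclideanSpace.norm_sq_eq, sum_word_add]; simp

lemma N_adjR_le {x z : TS d} (hx : N x ≠ ⊤) (hz : N z ≠ ⊤) : N (TS.adjR x z) ≤ N x * N z := by
  have h0 : ∑' n, ∑' k, ‖lv x k‖ₑ * ‖lv z (n + k)‖ₑ ≤ N x * N z := by
    refine le_of_eq_of_le ?_ (adj_sum x z)
    exact tsum_congr fun n => tsum_congr fun k => by rw [add_comm n k]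
  refine le_trans (ENNReal.tsum_le_tsum fun n => ?_) h0
  refine adj_aux n x z (fun k v w => z (n + k) (Fin.append w v)) (fun k => n + k) (fun k => ?_) hx hz
  rw [EuclideanSpace.norm_sq_eq, sum_word_add, Finset.sum_comm]; simp

lemma adjL_fin {x z : TS d} (hx : N x ≠ ⊤) (hz : N z ≠ ⊤) : N (TS.adjL x z) ≠ ⊤ :=
  ne_top_of_le_ne_top (ENNReal.mul_ne_top hx hz) (N_adjL_le hx hz)
lemma adjR_fin {x z : TS d} (hx : N x ≠ ⊤) (hz : N z ≠ ⊤) : N (TS.adjR x z) ≠ ⊤ :=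
  ne_top_of_le_ne_top (ENNReal.mul_ne_top hx hz) (N_adjR_le hx hz)
lemma reduce_fin {x : TS d} (hx : N x ≠ ⊤) : N (TS.reduce x) ≠ ⊤ :=
  ne_top_of_le_ne_top hx (N_reduce_le x)
lemma add_fin {x y : TS d} (hx : N x ≠ ⊤) (hy : N y ≠ ⊤) : N (x + y) ≠ ⊤ :=
  ne_top_of_le_ne_top (ENNReal.add_ne_top.2 ⟨hx, hy⟩) (N_add_le x y)
lemma sub_fin {x y : TS d} (hx : N x ≠ ⊤) (hy : N y ≠ ⊤) : N (x - y) ≠ ⊤ :=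
  ne_top_of_le_ne_top (ENNReal.add_ne_top.2 ⟨hx, hy⟩) (N_sub_le x y)
lemma smul_fin (c : ℝ) {x : TS d} (hx : N x ≠ ⊤) : N (c • x) ≠ ⊤ := by
  rw [N_smul]; exact ENNReal.mul_ne_top (by simp) hx
lemma one_fin : N (TS.one : TS d) ≠ ⊤ := by rw [N_one]; simp

/-- shifts are bounded -/
lemma N_sh_le (l : List (Fin d)) (z : TS d) : N (sh l z) ≤ N z := by
  have h1 : ∀ k, ‖lv (sh l z) k‖ₑ ≤ ‖lv z (k + l.length)‖ₑ := by
    intro k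
    rw [← ofReal_norm, ← ofReal_norm]
    apply ENNReal.ofReal_le_ofReal
    refine le_of_sq_le' ?_ (by positivity)
    rw [EuclideanSpace.norm_sq_eq, EuclideanSpace.norm_sq_eq, sum_word_add]
    apply Finset.sum_le_sum
    intro v _
    have : sh l z k v = z (k + l.length) (Fin.append v l.get) := by
      rw [← sh_apply z (l.get : Word d l.length) v]; simp
    change ‖sh l z k v‖ ^ 2 ≤ _
    rw [this]
    exact Finset.single_le_sum (f := fun u : Word d l.length => ‖z (k + l.length) (Fin.append v u)‖ ^ 2)
      (fun _ _ => by positivity) (Finset.mem_univ (l.get : Word d l.length))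
  refine (ENNReal.tsum_le_tsum h1).trans ?_
  exact ENNReal.tsum_comp_le_tsum_of_injective (add_left_injective _) (fun n => ‖lv z n‖ₑ)

lemma sh_fin (l : List (Fin d)) {z : TS d} (hz : N z ≠ ⊤) : N (sh l z) ≠ ⊤ :=
  ne_top_of_le_ne_top hz (N_sh_le l z)

lemma N_shR_le (l : List (Fin d)) (z : TS d) : N (shR l z) ≤ N z := by
  have h1 : ∀ k, ‖lv (shR l z) k‖ₑ ≤ ‖lv z (l.length + k)‖ₑ := by
    intro k
    rw [← ofReal_norm, ← ofReal_norm]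
    apply ENNReal.ofReal_le_ofReal
    refine le_of_sq_le' ?_ (by positivity)
    rw [EuclideanSpace.norm_sq_eq, EuclideanSpace.norm_sq_eq, sum_word_add, Finset.sum_comm]
    apply Finset.sum_le_sum
    intro v _
    have : shR l z k v = z (l.length + k) (Fin.append l.get v) := by
      rw [← shR_apply z (l.get : Word d l.length) v]; simp
    change ‖shR l z k v‖ ^ 2 ≤ _
    rw [this]
    exact Finset.single_le_sum (f := fun u : Word d l.length => ‖z (l.length + k) (Fin.append u v)‖ ^ 2)
      (fun _ _ => by positivity) (Finset.mem_univ (l.get : Word d l.length))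
  refine (ENNReal.tsum_le_tsum h1).trans ?_
  exact ENNReal.tsum_comp_le_tsum_of_injective (add_right_injective _) (fun n => ‖lv z n‖ₑ)

lemma shR_fin (l : List (Fin d)) {z : TS d} (hz : N z ≠ ⊤) : N (shR l z) ≠ ⊤ :=
  ne_top_of_le_ne_top hz (N_shR_le l z)

/-- product -/
lemma mul_comp (x y : TS d) (n k m : ℕ) (h : n = k + m) :
    ‖(WithLp.toLp 2 fun w : Word d n => L x ((List.ofFn w).take k) * L y ((List.ofFn w).drop k) :
      EuclideanSpace ℝ (Word d n))‖ₑ ≤ ‖lv x k‖ₑ * ‖lv y m‖ₑ := by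
  subst h
  rw [← ofReal_norm, ← ofReal_norm, ← ofReal_norm, ← ENNReal.ofReal_mul (norm_nonneg _)]
  apply ENNReal.ofReal_le_ofReal
  refine le_of_sq_le' ?_ (by positivity)
  rw [mul_pow, EuclideanSpace.norm_sq_eq, EuclideanSpace.norm_sq_eq, EuclideanSpace.norm_sq_eq,
    sum_word_add, Finset.sum_mul_sum]
  apply le_of_eq
  refine Finset.sum_congr rfl fun v _ => Finset.sum_congr rfl fun u _ => ?_
  rw [← mul_pow, ← norm_mul]
  have h1 : (List.ofFn v ++ List.ofFn u).take k = List.ofFn v := List.take_left' (by simp)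
  have h2 : (List.ofFn v ++ List.ofFn u).drop k = List.ofFn u := List.drop_left' (by simp)
  simp only [List.ofFn_fin_append, h1, h2, L_ofFn]

lemma N_mul_le (x y : TS d) : N (TS.mul x y) ≤ N x * N y := by
  have h1 : ∀ n, ‖lv (TS.mul x y) n‖ₑ ≤
      ∑ p ∈ Finset.HasAntidiagonal.antidiagonal n, ‖lv x p.1‖ₑ * ‖lv y p.2‖ₑ := by
    intro n
    rw [Finset.Nat.sum_antidiagonal_eq_sum_range_succ (fun i j => ‖lv x i‖ₑ * ‖lv y j‖ₑ)]
    have : lv (TS.mul x y) n = ∑ k ∈ Finset.range (n + 1),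
      (WithLp.toLp 2 fun w : Word d n => L x ((List.ofFn w).take k) * L y ((List.ofFn w).drop k) :
      EuclideanSpace ℝ (Word d n)) := by
      ext w; simp [mul_eq]
    rw [this]
    refine (enorm_sum_le _ _).trans (Finset.sum_le_sum fun k hk => ?_)
    exact mul_comp x y n k (n - k) (by simp at hk; omega)
  refine (ENNReal.tsum_le_tsum h1).trans (le_of_eq ?_)
  unfold N
  rw [← ENNReal.tsum_mul_right]
  simp_rw [← ENNReal.tsum_mul_left]
  rw [← ENNReal.tsum_prod,
    ← Finset.HasAntidiagonal.sigmaAntidiagonalEquivProd.tsum_eq, ENNReal.tsum_sigma']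
  congr 1; ext n
  rw [tsum_fintype, ← Finset.sum_coe_sort]
  rfl

lemma mul_fin {x y : TS d} (hx : N x ≠ ⊤) (hy : N y ≠ ⊤) : N (TS.mul x y) ≠ ⊤ :=
  ne_top_of_le_ne_top (ENNReal.mul_ne_top hx hy) (N_mul_le x y)

lemma trunc_mul (M : ℕ) (x y : TS d) :
    N (TS.truncate M (TS.mul x y)) ≤ N (TS.truncate M x) * N y := by
  have : TS.truncate M (TS.mul x y) = TS.truncate M (TS.mul (TS.truncate M x) y) := by
    ext n w
    unfold TS.truncate
    split_ifs with h
    · unfold TS.mul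
      refine Finset.sum_congr rfl fun k _ => ?_
      have := k.2
      beta_reduce
      rw [if_pos (by omega)]
    · rfl
  rw [this]
  exact (N_trunc_le _ _).trans (N_mul_le _ _)

/-- splitting equivalence -/
def splitEquiv (α : Type) : List α × List α ≃ Σ l : List α, Fin (l.length + 1) where
  toFun p := ⟨p.1 ++ p.2, ⟨p.1.length, by simp⟩⟩
  invFun q := (q.1.take q.2, q.1.drop q.2)
  left_inv p := by simp
  right_inv q := by
    obtain ⟨l, k, hk⟩ := q
    have h : l.take k ++ l.drop k = l := List.take_append_drop k l
    refine Sigma.ext (by simp) ?_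
    simp only
    refine (Fin.heq_ext_iff (by rw [h])).2 ?_
    simp; omega

lemma tri_summable {a b c : TS d} (ha : N a ≠ ⊤) (hb : N b ≠ ⊤) (hc : N c ≠ ⊤) :
    Summable fun p : List (Fin d) × List (Fin d) => L b p.1 * L c p.2 * L a (p.1 ++ p.2) := by
  apply Summable.of_enorm
  rw [ENNReal.tsum_prod', ENNReal.tsum_comm]
  have ha' : N (ab a) ≠ ⊤ := by rwa [N_ab]
  have hb' : N (ab b) ≠ ⊤ := by rwa [N_ab]
  have key : ∀ v2 : List (Fin d), ∑' v1, ‖L b v1 * L c v2 * L a (v1 ++ v2)‖ₑ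
      = ‖L (TS.adjL (ab b) (ab a)) v2‖ₑ * ‖L c v2‖ₑ := by
    intro v2
    rw [L_adjL, pairing_list hb' (sh_fin _ ha')]
    have hs := list_summable hb' (sh_fin v2 ha')
    rw [Real.enorm_of_nonneg, ENNReal.ofReal_tsum_of_nonneg _ hs, ← ENNReal.tsum_mul_right]
    · refine tsum_congr fun v1 => ?_
      rw [← Real.enorm_of_nonneg, ← enorm_mul]
      · rw [← enorm_abs' (L b v1 * _ * _), ← enorm_abs' (_ * L c v2)]
        congr 1
        rw [sh, L_T, L_ab, L_ab]
        simp only [abs_mul, abs_abs]; ring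
      · rw [sh, L_T, L_ab, L_ab]; positivity
    · intro v1; rw [sh, L_T, L_ab, L_ab]; positivity
    · refine tsum_nonneg fun v1 => ?_
      rw [sh, L_T, L_ab, L_ab]; positivity
  simp_rw [key]
  exact ne_top_of_le_ne_top (ENNReal.mul_ne_top (adjL_fin hb' ha') hc) (tsum_list_le _ _)

lemma tri_mul {a b c : TS d} (ha : N a ≠ ⊤) (hb : N b ≠ ⊤) (hc : N c ≠ ⊤) :
    TS.pairing a (TS.mul b c) =
      ∑' p : List (Fin d) × List (Fin d), L b p.1 * L c p.2 * L a (p.1 ++ p.2) := by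
  have hs := tri_summable ha hb hc
  rw [pairing_list ha (mul_fin hb hc)]
  rw [← (splitEquiv (Fin d)).symm.tsum_eq]
  rw [← (splitEquiv (Fin d)).symm.summable_iff] at hs
  change _ = ∑' q, ((fun p : List (Fin d) × List (Fin d) =>
    L b p.1 * L c p.2 * L a (p.1 ++ p.2)) ∘ (splitEquiv (Fin d)).symm) q
  rw [Summable.tsum_sigma' (fun n => Summable.of_finite) hs]
  refine tsum_congr fun l => ?_
  rw [tsum_fintype, L_mul, Finset.mul_sum, Finset.sum_range]
  refine Finset.sum_congr rfl fun k _ => ?_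
  simp [splitEquiv]; ring

lemma tri_adjL {a b c : TS d} (ha : N a ≠ ⊤) (hb : N b ≠ ⊤) (hc : N c ≠ ⊤) :
    TS.pairing (TS.adjL b a) c = TS.pairing a (TS.mul b c) := by
  have hs := tri_summable ha hb hc
  rw [tri_mul ha hb hc, pairing_list (adjL_fin hb ha) hc]
  rw [← (Equiv.prodComm (List (Fin d)) (List (Fin d))).tsum_eq]
  rw [← (Equiv.prodComm (List (Fin d)) (List (Fin d))).summable_iff] at hs
  change _ = ∑' q, ((fun p : List (Fin d) × List (Fin d) =>
    L b p.1 * L c p.2 * L a (p.1 ++ p.2)) ∘ (Equiv.prodComm (List (Fin d)) (List (Fin d)))) q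
  rw [Summable.tsum_prod hs]
  refine tsum_congr fun v2 => ?_
  rw [L_adjL, pairing_list hb (sh_fin _ ha), ← tsum_mul_right]
  refine tsum_congr fun v1 => ?_
  rw [sh, L_T]; simp; ring

lemma tri_adjR {a b c : TS d} (ha : N a ≠ ⊤) (hb : N b ≠ ⊤) (hc : N c ≠ ⊤) :
    TS.pairing (TS.adjR c a) b = TS.pairing a (TS.mul b c) := by
  have hs := tri_summable ha hb hc
  rw [tri_mul ha hb hc, pairing_list (adjR_fin hc ha) hb]
  rw [Summable.tsum_prod hs]
  refine tsum_congr fun v1 => ?_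
  rw [L_adjR, pairing_list hc (shR_fin _ ha), ← tsum_mul_right]
  refine tsum_congr fun v2 => ?_
  rw [shR, L_T]; ring

lemma L_add (x y : TS d) (l) : L (x + y) l = L x l + L y l := rfl
lemma L_smul (c : ℝ) (x : TS d) (l) : L (c • x) l = c * L x l := rfl
lemma L_sum {ι : Type} (s : Finset ι) (f : ι → TS d) (l) : L (∑ i ∈ s, f i) l = ∑ i ∈ s, L (f i) l := by
  simp [L]
lemma L_inj {x y : TS d} (h : ∀ l, L x l = L y l) : x = y := by
  rw [← T_L x, ← T_L y]; congr 1; ext l; exact h l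

lemma sh_mul (l : List (Fin d)) (b y : TS d) : sh l (TS.mul b y) =
    TS.mul b (TS.reduce (sh l y)) +
      ∑ j ∈ Finset.range (l.length + 1), L y (l.drop j) • sh (l.take j) b := by
  apply L_inj
  intro v
  rw [sh, L_T_apply, L_add, L_sum, L_mul, L_mul]
  simp only [L_smul, L_reduce, sh, L_T_apply]
  rw [List.length_append, add_assoc, Finset.sum_range_add, Finset.sum_range_succ _ v.length]
  congr 1
  · rw [List.drop_length]
    simp only [if_true, mul_zero, add_zero]
    refine Finset.sum_congr rfl fun k hk => ?_
    have hk' : k < v.length := by simpa using hk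
    rw [if_neg (by simp; omega), List.take_append_of_le_length hk'.le,
      List.drop_append_of_le_length hk'.le]
  · refine Finset.sum_congr rfl fun j _ => ?_
    rw [List.take_length_add_append, List.drop_length_add_append]; ring

lemma pairing_sum_right {ι : Type} (s : Finset ι) {x : TS d} (f : ι → TS d) (hx : N x ≠ ⊤)
    (hf : ∀ i, N (f i) ≠ ⊤) :
    N (∑ i ∈ s, f i) ≠ ⊤ ∧ TS.pairing x (∑ i ∈ s, f i) = ∑ i ∈ s, TS.pairing x (f i) := by
  classical
  induction s using Finset.induction_on with
  | empty =>
    simp only [Finset.sum_empty]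
    refine ⟨by rw [N_zero]; simp, ?_⟩
    simp [TS.pairing]
  | insert i s hi ih =>
    rw [Finset.sum_insert hi, Finset.sum_insert hi]
    exact ⟨add_fin (hf i) ih.1, by rw [pairing_add_right hx (hf i) ih.1, ih.2]⟩

/-- the main algebraic identity -/
lemma adjL_mul {a b y : TS d} (ha : N a ≠ ⊤) (hb : N b ≠ ⊤) (hy : N y ≠ ⊤) :
    TS.adjL a (TS.mul b y) = TS.mul (TS.adjL a b) y + TS.adjL (TS.reduce (TS.adjL b a)) y := by
  apply L_inj
  intro l
  have h := pairing_sum_right (Finset.range (l.length + 1)) (x := a)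
    (fun j => L y (l.drop j) • sh (l.take j) b) ha (fun j => smul_fin _ (sh_fin _ hb))
  rw [L_adjL, sh_mul, pairing_add_right ha (mul_fin hb (reduce_fin (sh_fin _ hy))) h.1, h.2,
    ← tri_adjL ha hb (reduce_fin (sh_fin _ hy)), L_add, L_adjL, L_mul, ← pairing_reduce, add_comm]
  congr 1
  refine Finset.sum_congr rfl fun j _ => ?_
  rw [pairing_smul_right, L_adjL, mul_comm]

lemma adjL_decomp (a b : TS d) :
    TS.adjL a b = TS.pairing a b • TS.one + TS.reduce (TS.adjL a b) := by
  apply L_inj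
  intro l
  rw [L_add, L_smul, L_one, L_reduce]
  split_ifs with h
  · subst h
    rw [L_adjL]
    have : sh [] b = b := by apply L_inj; intro l; rw [sh, L_T_apply]; simp
    rw [this]; ring
  · ring

lemma one_mul' (y : TS d) : TS.mul TS.one y = y := by
  apply L_inj; intro l
  rw [L_mul, Finset.sum_eq_single 0]
  · simp [L_one]
  · intro k hk hk0
    rw [L_one, if_neg, zero_mul]
    simp at hk ⊢
    refine ⟨hk0, ?_⟩
    rintro h; subst h; simp at hk; omega
  · simp

lemma mul_add_left (x y z : TS d) : TS.mul (x + y) z = TS.mul x z + TS.mul y z := by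
  apply L_inj; intro l
  simp only [L_mul, L_add, add_mul, Finset.sum_add_distrib]
lemma mul_smul_left (c : ℝ) (x z : TS d) : TS.mul (c • x) z = c • TS.mul x z := by
  apply L_inj; intro l
  simp only [L_mul, L_smul, mul_assoc, Finset.mul_sum]
lemma mul_sub_left (x y z : TS d) : TS.mul (x - y) z = TS.mul x z - TS.mul y z := by
  have : ∀ u v : TS d, u - v = u + (-1 : ℝ) • v := fun u v => by simp [sub_eq_add_neg]
  rw [this, this, mul_add_left, mul_smul_left]

lemma adjL_mul' {a b y : TS d} (ha : N a ≠ ⊤) (hb : N b ≠ ⊤) (hy : N y ≠ ⊤) :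
    TS.adjL a (TS.mul b y) = TS.pairing a b • y + TS.mul (TS.reduce (TS.adjL a b)) y +
      TS.adjL (TS.reduce (TS.adjL b a)) y := by
  rw [adjL_mul ha hb hy]
  conv_lhs => rw [adjL_decomp a b, mul_add_left, mul_smul_left, one_mul']

lemma pair_mul_mul {b c y z : TS d} (hb : N b ≠ ⊤) (hc : N c ≠ ⊤) (hy : N y ≠ ⊤) (hz : N z ≠ ⊤) :
    TS.pairing (TS.mul b y) (TS.mul c z) =
      TS.pairing b c * TS.pairing y z
        + TS.pairing (TS.reduce (TS.adjL c b)) (TS.reduce (TS.adjR y z))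
        + TS.pairing (TS.reduce (TS.adjL b c)) (TS.reduce (TS.adjR z y)) := by
  have h1 := reduce_fin (adjL_fin hb hc)
  have h2 := reduce_fin (adjL_fin hc hb)
  have hr : ∀ x : TS d, TS.reduce (TS.reduce x) = TS.reduce x := by
    intro x; ext n w; simp only [TS.reduce]; split_ifs <;> rfl
  rw [pairing_comm, ← tri_adjL (mul_fin hc hz) hb hy, adjL_mul' hb hc hz, pairing_comm,
    pairing_add_right hy (add_fin (smul_fin _ hz) (mul_fin h1 hz)) (adjL_fin h2 hz),
    pairing_add_right hy (smul_fin _ hz) (mul_fin h1 hz), pairing_smul_right,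
    ← tri_adjR hy h1 hz, pairing_comm y (TS.adjL _ z), tri_adjL hz h2 hy, ← tri_adjR hz h2 hy,
    ← hr (TS.adjL b c), ← hr (TS.adjL c b), ← pairing_reduce (TS.adjR z y),
    ← pairing_reduce (TS.adjR y z), hr, hr,
    pairing_comm (TS.reduce (TS.adjR z y)), pairing_comm (TS.reduce (TS.adjR y z))]
  ring

lemma adjL_add_left {x y z : TS d} (hx : N x ≠ ⊤) (hy : N y ≠ ⊤) (hz : N z ≠ ⊤) :
    TS.adjL (x + y) z = TS.adjL x z + TS.adjL y z := by
  apply L_inj; intro l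
  simp only [L_add, L_adjL]
  rw [pairing_comm, pairing_add_right (sh_fin _ hz) hx hy, pairing_comm, pairing_comm y]

lemma adjL_sub_left {x y z : TS d} (hx : N x ≠ ⊤) (hy : N y ≠ ⊤) (hz : N z ≠ ⊤) :
    TS.adjL (x - y) z = TS.adjL x z - TS.adjL y z := by
  apply L_inj; intro l
  change _ = L (TS.adjL x z) l - L (TS.adjL y z) l
  simp only [L_adjL]
  rw [pairing_comm, pairing_sub_right (sh_fin _ hz) hx hy, pairing_comm, pairing_comm y]

lemma sh_sub (l) (x y : TS d) : sh l (x - y) = sh l x - sh l y := rfl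
lemma sh_add (l) (x y : TS d) : sh l (x + y) = sh l x + sh l y := rfl

lemma adjL_sub_right {x y z : TS d} (hx : N x ≠ ⊤) (hy : N y ≠ ⊤) (hz : N z ≠ ⊤) :
    TS.adjL z (x - y) = TS.adjL z x - TS.adjL z y := by
  apply L_inj; intro l
  change _ = L (TS.adjL z x) l - L (TS.adjL z y) l
  simp only [L_adjL]
  rw [sh_sub, pairing_sub_right hz (sh_fin _ hx) (sh_fin _ hy)]

lemma reduce_sub (x y : TS d) : TS.reduce (x - y) = TS.reduce x - TS.reduce y := by
  ext n w; simp only [TS.reduce, Pi.sub_apply]; split_ifs <;> simp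

end PS
open scoped BigOperators ENNReal
open MeasureTheory

namespace PS
variable {d : ℕ}

section meas
variable {X : Type*} [MeasurableSpace X]

def MM (F : X → TS d) : Prop := ∀ n w, Measurable fun r => F r n w

lemma MM.lv {F : X → TS d} (h : MM F) (n : ℕ) : Measurable fun r => ‖lv (F r) n‖ₑ := by
  have : (fun r => ‖PS.lv (F r) n‖ₑ) = fun r => ENNReal.ofReal (TS.levelNorm (F r) n) := by
    ext r; rw [levelNorm_eq, ofReal_norm]
  rw [this]
  unfold TS.levelNorm
  refine ENNReal.measurable_ofReal.comp (Real.continuous_sqrt.measurable.comp ?_)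
  exact Finset.measurable_sum _ fun w _ => (h n w).pow_const 2

lemma MM.N {F : X → TS d} (h : MM F) : Measurable fun r => N (F r) :=
  Measurable.tsum fun n => h.lv n

lemma MM.add {F G : X → TS d} (hF : MM F) (hG : MM G) : MM fun r => F r + G r :=
  fun n w => (hF n w).add (hG n w)
lemma MM.sub {F G : X → TS d} (hF : MM F) (hG : MM G) : MM fun r => F r - G r :=
  fun n w => (hF n w).sub (hG n w)
lemma MM.smul {c : X → ℝ} {F : X → TS d} (hc : Measurable c) (hF : MM F) : MM fun r => c r • F r :=
  fun n w => hc.mul (hF n w)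
lemma MM.reduce {F : X → TS d} (hF : MM F) : MM fun r => TS.reduce (F r) := by
  intro n w; unfold TS.reduce; by_cases h : n = 0
  · simp [h]
  · simpa [h] using hF n w
lemma MM.trunc {F : X → TS d} (M : ℕ) (hF : MM F) : MM fun r => TS.truncate M (F r) := by
  intro n w; unfold TS.truncate; by_cases h : n ≤ M
  · simpa [h] using hF n w
  · simp [h]
lemma MM.sh {F : X → TS d} (l : List (Fin d)) (hF : MM F) : MM fun r => sh l (F r) :=
  fun _ _ => hF _ _
lemma MM.shR {F : X → TS d} (l : List (Fin d)) (hF : MM F) : MM fun r => shR l (F r) :=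
  fun _ _ => hF _ _
lemma MM.mul {F G : X → TS d} (hF : MM F) (hG : MM G) : MM fun r => TS.mul (F r) (G r) := by
  intro n w; unfold TS.mul
  exact Finset.measurable_sum _ fun k _ => (hF _ _).mul (hG _ _)
lemma MM.pairing {F G : X → TS d} (hF : MM F) (hG : MM G) (hF' : ∀ r, PS.N (F r) ≠ ⊤)
    (hG' : ∀ r, PS.N (G r) ≠ ⊤) : Measurable fun r => TS.pairing (F r) (G r) := by
  refine measurable_of_tendsto_metrizable
    (f := fun (n : ℕ) r => ∑ k ∈ Finset.range n, ∑ w, F r k w * G r k w) (fun n => ?_) ?_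
  · exact Finset.measurable_sum _ fun k _ => Finset.measurable_sum _ fun w _ => (hF k w).mul (hG k w)
  · rw [tendsto_pi_nhds]
    intro r
    exact (pairing_summable (hF' r) (hG' r)).hasSum.tendsto_sum_nat
lemma MM.adjL {F G : X → TS d} (hF : MM F) (hG : MM G) (hF' : ∀ r, PS.N (F r) ≠ ⊤)
    (hG' : ∀ r, PS.N (G r) ≠ ⊤) : MM fun r => TS.adjL (F r) (G r) := by
  intro n w
  simp only [adjL_eq]
  exact hF.pairing (hG.sh _) hF' fun r => sh_fin _ (hG' r)
lemma MM.adjR {F G : X → TS d} (hF : MM F) (hG : MM G) (hF' : ∀ r, PS.N (F r) ≠ ⊤)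
    (hG' : ∀ r, PS.N (G r) ≠ ⊤) : MM fun r => TS.adjR (F r) (G r) := by
  intro n w
  simp only [adjR_eq]
  exact hF.pairing (hG.shR _) hF' fun r => shR_fin _ (hG' r)
lemma MM.comp {Y : Type*} [MeasurableSpace Y] {F : X → TS d} (hF : MM F) {g : Y → X}
    (hg : Measurable g) : MM fun r => F (g r) := fun n w => (hF n w).comp hg

/-- componentwise integral -/
noncomputable def Z (ν : Measure X) (F : X → TS d) : TS d := fun n w => ∫ r, F r n w ∂ν

variable {ν : Measure X} {F : X → TS d}

lemma comp_int (hF : MM F) (h : ∫⁻ r, N (F r) ∂ν ≠ ⊤) (n w) : Integrable (fun r => F r n w) ν := by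
  refine ⟨(hF n w).aestronglyMeasurable, ?_⟩
  refine lt_of_le_of_lt (lintegral_mono fun r => comp_le_N (F r) n w) h.lt_top

lemma N_Z_le (hF : MM F) : N (Z ν F) ≤ ∫⁻ r, N (F r) ∂ν := by
  by_cases h : ∫⁻ r, N (F r) ∂ν = ⊤
  · rw [h]; exact le_top
  have h1 : ∀ n, ‖lv (Z ν F) n‖ₑ ≤ ∫⁻ r, ‖lv (F r) n‖ₑ ∂ν := by
    intro n
    have : lv (Z ν F) n = ∫ r, lv (F r) n ∂ν := by
      ext w
      have hi : Integrable (fun r => lv (F r) n) ν :=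
        Integrable.of_eval_piLp fun w => comp_int hF h n w
      exact (EuclideanSpace.proj (𝕜 := ℝ) w).integral_comp_comm hi
    rw [this]
    exact enorm_integral_le_lintegral_enorm _
  refine (ENNReal.tsum_le_tsum h1).trans (le_of_eq ?_)
  rw [← lintegral_tsum fun n => (hF.lv n).aemeasurable]
  rfl

lemma Z_fin (hF : MM F) (h : ∫⁻ r, N (F r) ∂ν ≠ ⊤) : N (Z ν F) ≠ ⊤ :=
  ne_top_of_le_ne_top h (N_Z_le hF)

lemma pairing_Z {x : TS d} (hx : N x ≠ ⊤) (hF : MM F) (h : ∫⁻ r, N (F r) ∂ν ≠ ⊤) :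
    TS.pairing x (Z ν F) = ∫ r, TS.pairing x (F r) ∂ν := by
  unfold TS.pairing
  rw [integral_tsum]
  · refine tsum_congr fun n => ?_
    rw [integral_finsetSum _ fun w _ => (comp_int hF h n w).const_mul _]
    refine Finset.sum_congr rfl fun w _ => ?_
    rw [integral_const_mul]; rfl
  · intro n
    exact (Finset.measurable_sum _ fun w _ => (hF n w).const_mul _).aestronglyMeasurable
  · rw [← lintegral_tsum]
    · apply ne_top_of_le_ne_top (ENNReal.mul_ne_top hx h)
      rw [← lintegral_const_mul _ hF.N]
      refine lintegral_mono fun r => ?_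
      exact (ENNReal.tsum_le_tsum fun n => lv_pair x (F r) n).trans (tsum_lv_mul _ _)
    · intro n
      exact (Finset.measurable_sum _ fun w _ => (hF n w).const_mul _).enorm.aemeasurable

lemma lint_sh (l) (h : ∫⁻ r, N (F r) ∂ν ≠ ⊤) : ∫⁻ r, N (sh l (F r)) ∂ν ≠ ⊤ :=
  ne_top_of_le_ne_top h (lintegral_mono fun r => N_sh_le l (F r))

lemma adjL_Z {x : TS d} (hx : N x ≠ ⊤) (hF : MM F) (h : ∫⁻ r, N (F r) ∂ν ≠ ⊤) :
    TS.adjL x (Z ν F) = Z ν fun r => TS.adjL x (F r) := by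
  ext n w
  rw [adjL_eq]
  have : sh (List.ofFn w) (Z ν F) = Z ν fun r => sh (List.ofFn w) (F r) := rfl
  rw [this, pairing_Z hx (hF.sh _) (lint_sh _ h)]
  simp only [Z, adjL_eq]

end meas

section NC
open Filter Topology
variable {X : Type*} [TopologicalSpace X]

def NC (F : X → TS d) : Prop := ∀ p, Tendsto (fun q => N (F q - F p)) (𝓝 p) (𝓝 0)

lemma NC.comp_cont {F : X → TS d} (h : NC F) (n w) : Continuous fun q => F q n w := by
  rw [continuous_iff_continuousAt]
  intro p
  rw [ContinuousAt, tendsto_iff_edist_tendsto_0]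
  refine tendsto_of_tendsto_of_tendsto_of_le_of_le tendsto_const_nhds (h p) (fun _ => zero_le) ?_
  intro q
  simp only [edist_eq_enorm_sub]
  exact comp_le_N (F q - F p) n w

lemma NC.MM [MeasurableSpace X] [OpensMeasurableSpace X] {F : X → TS d} (h : NC F) : MM F :=
  fun n w => (h.comp_cont n w).measurable

lemma N_fin_tri {a b : TS d} : N a ≤ N (a - b) + N b := by
  have := N_add_le (a - b) b
  rwa [sub_add_cancel] at this

lemma NC.N_cont {F : X → TS d} (h : NC F) (hf : ∀ p, PS.N (F p) ≠ ⊤) :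
    Continuous fun q => N (F q) := by
  rw [continuous_iff_continuousAt]
  intro p
  rw [ContinuousAt, ENNReal.tendsto_nhds (hf p)]
  intro ε hε
  have h1 := (h p).eventually (gt_mem_nhds hε)
  filter_upwards [h1] with q hq
  constructor
  · rw [tsub_le_iff_left]
    refine (N_fin_tri (b := F q)).trans ?_
    rw [N_sub_comm]; gcongr
  · rw [add_comm]; refine (N_fin_tri (b := F p)).trans ?_
    gcongr

lemma NC.comp {Y : Type*} [TopologicalSpace Y] {F : X → TS d} (h : NC F) {g : Y → X}
    (hg : Continuous g) : NC fun q => F (g q) := by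
  intro p
  exact (h (g p)).comp (hg.tendsto p)

lemma NC.reduce {F : X → TS d} (h : NC F) : NC fun q => TS.reduce (F q) := by
  intro p
  refine tendsto_of_tendsto_of_tendsto_of_le_of_le tendsto_const_nhds (h p) (fun _ => zero_le) ?_
  intro q
  simp only [← reduce_sub]
  exact N_reduce_le _

lemma bil_tendsto {F G : X → TS d} (hF : NC F) (hG : NC G)
    (hG' : ∀ r, PS.N (G r) ≠ ⊤) (hF' : ∀ r, PS.N (F r) ≠ ⊤) (p : X) :
    Tendsto (fun q => N (F q - F p) * N (G q) + N (F p) * N (G q - G p)) (𝓝 p) (𝓝 0) := by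
  have h1 := ENNReal.Tendsto.mul (hF p) (Or.inr (hG' p)) ((hG.N_cont hG').tendsto p) (Or.inr (by simp))
  have h2 := ENNReal.Tendsto.const_mul (a := N (F p)) (hG p) (Or.inr (hF' p))
  simpa using h1.add h2

lemma NC.adjL {F G : X → TS d} (hF : NC F) (hG : NC G) (hF' : ∀ r, PS.N (F r) ≠ ⊤)
    (hG' : ∀ r, PS.N (G r) ≠ ⊤) : NC fun r => TS.adjL (F r) (G r) := by
  intro p
  refine tendsto_of_tendsto_of_tendsto_of_le_of_le tendsto_const_nhds
    (bil_tendsto hF hG hG' hF' p) (fun _ => zero_le) ?_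
  intro q
  have : TS.adjL (F q) (G q) - TS.adjL (F p) (G p)
      = TS.adjL (F q - F p) (G q) + TS.adjL (F p) (G q - G p) := by
    rw [adjL_sub_left (hF' _) (hF' _) (hG' _), adjL_sub_right (hG' _) (hG' _) (hF' _)]; abel
  simp only [this]
  refine (N_add_le _ _).trans (add_le_add ?_ ?_)
  · exact N_adjL_le (sub_fin (hF' _) (hF' _)) (hG' _)
  · exact N_adjL_le (hF' _) (sub_fin (hG' _) (hG' _))

lemma NC.pairing {F G : X → TS d} (hF : NC F) (hG : NC G) (hF' : ∀ r, PS.N (F r) ≠ ⊤)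
    (hG' : ∀ r, PS.N (G r) ≠ ⊤) : Continuous fun r => TS.pairing (F r) (G r) := by
  have h := (hF.adjL hG hF' hG').comp_cont 0 ![]
  convert h using 2 with r
  rw [adjL_eq]
  congr 1
  apply L_inj; intro l; rw [sh, L_T_apply]; simp

end NC

end PS
open scoped BigOperators ENNReal
open MeasureTheory

namespace PS
variable {d : ℕ}
open Filter Topology Set

structure Nice (y : ℝ → TS d) : Prop where
  meas : MM y
  fin : ∀ r, N (y r) ≠ ⊤
  zero : ∀ r w, y r 0 w = 0
  neg : ∀ r ≤ 0, y r = 0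
  int : ∀ t : ℝ, ∫⁻ r in Ioc 0 t, N (y r) ≠ ⊤

noncomputable def kk (y : ℝ → TS d) (r : ℝ) : ℝ := (N (y r)).toReal
noncomputable def KK (y : ℝ → TS d) (t : ℝ) : ℝ := ∫ r in (0:ℝ)..t, kk y r
noncomputable def EE (y : ℝ → TS d) (t : ℝ) : ℝ≥0∞ := ENNReal.ofReal (Real.exp (3 * KK y t))

section
variable {y : ℝ → TS d} (h : Nice y)
include h

lemma Nice.ofReal_kk (r : ℝ) : ENNReal.ofReal (kk y r) = N (y r) := ENNReal.ofReal_toReal (h.fin r)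

lemma Nice.kk_int (a b : ℝ) : IntervalIntegrable (kk y) volume a b := by
  have h1 : ∀ t : ℝ, IntegrableOn (kk y) (Iic t) := by
    intro t
    have h2 : IntegrableOn (kk y) (Ioc 0 t) := by
      refine ⟨h.meas.N.ennreal_toReal.aestronglyMeasurable, ?_⟩
      refine lt_of_le_of_lt (lintegral_mono fun r => ?_) (h.int t).lt_top
      rw [kk, Real.enorm_of_nonneg ENNReal.toReal_nonneg]
      exact ENNReal.ofReal_toReal_le
    have h3 : IntegrableOn (kk y) (Iic 0) := by
      refine (integrableOn_zero : IntegrableOn (fun _ => (0:ℝ)) (Iic (0:ℝ)) volume).congr_fun (fun r hr => ?_) measurableSet_Iic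
      simp [kk, h.neg r hr, N_zero]
    refine (h3.union h2).mono_set fun r hr => ?_
    by_cases h0 : r ≤ 0
    · exact Or.inl h0
    · exact Or.inr ⟨not_le.1 h0, hr⟩
  rw [intervalIntegrable_iff]
  exact (h1 (max a b)).mono_set fun r hr => hr.2

lemma Nice.KK_cont : Continuous (KK y) :=
  intervalIntegral.continuous_primitive h.kk_int 0

lemma Nice.KK_sub {s t : ℝ} (hst : s ≤ t) :
    ∫⁻ r in Ioc s t, N (y r) = ENNReal.ofReal (KK y t - KK y s) := by
  unfold KK
  rw [intervalIntegral.integral_interval_sub_left (h.kk_int _ _) (h.kk_int _ _),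
    intervalIntegral.integral_of_le hst, ofReal_integral_eq_lintegral_ofReal]
  · exact lintegral_congr fun r => (h.ofReal_kk r).symm
  · exact (intervalIntegrable_iff_integrableOn_Ioc_of_le hst).1 (h.kk_int s t)
  · exact Eventually.of_forall fun r => ENNReal.toReal_nonneg

lemma Nice.KK_mono : Monotone (KK y) := by
  intro s t hst
  unfold KK
  rw [← sub_nonneg, intervalIntegral.integral_interval_sub_left (h.kk_int _ _) (h.kk_int _ _)]
  exact intervalIntegral.integral_nonneg hst fun r _ => ENNReal.toReal_nonneg

lemma Nice.EE_mono : Monotone (EE y) := by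
  intro s t hst
  unfold EE
  have := h.KK_mono hst
  gcongr

lemma Nice.EE_cont : Continuous (EE y) := by
  have := h.KK_cont
  exact ENNReal.continuous_ofReal.comp (by fun_prop)

lemma Nice.EE_one {t : ℝ} (ht : 0 ≤ t) : 1 ≤ EE y t := by
  unfold EE
  rw [← ENNReal.ofReal_one]
  apply ENNReal.ofReal_le_ofReal
  apply Real.one_le_exp
  have := h.KK_mono ht
  have h0 : KK y 0 = 0 := by simp [KK]
  linarith

lemma Nice.weight {s : ℝ} (hs : 0 ≤ s) :
    ∫⁻ r in Ioc 0 s, EE y r * N (y r) ≤ 3⁻¹ * EE y s := by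
  let f : ℝ → ℝ := fun r => Real.exp (3 * KK y r)
  have hf : Monotone f := fun a b hab => by
    have := h.KK_mono hab
    simp only [f]; gcongr
  have hd : ∀ᵐ r, r ∈ Icc 0 s → deriv f r = 3 * (Real.exp (3 * KK y r) * kk y r) := by
    have := (h.kk_int 0 s).ae_hasDerivAt_integral
    filter_upwards [this] with r hr hr'
    rw [uIcc_of_le hs] at hr
    have h1 : HasDerivAt (KK y) (kk y r) r := hr hr' 0 ⟨le_rfl, hs⟩
    have := (h1.const_mul 3).exp
    rw [this.deriv]; ring
  have h1 := (hf.monotoneOn (uIcc 0 s)).intervalIntegral_deriv_mem_uIcc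
  have h2 := (hf.monotoneOn (uIcc 0 s)).intervalIntegrable_deriv
  rw [uIcc_of_le (by linarith [hf hs])] at h1
  have h3 := h1.2
  rw [intervalIntegral.integral_of_le hs] at h3
  have h4 : ENNReal.ofReal (∫ r in Ioc 0 s, deriv f r) = 3 * ∫⁻ r in Ioc 0 s, EE y r * N (y r) := by
    rw [ofReal_integral_eq_lintegral_ofReal]
    · rw [← lintegral_const_mul' _ _ (by simp)]
      apply setLIntegral_congr_fun_ae measurableSet_Ioc
      filter_upwards [hd] with r hr hr'
      rw [hr (Ioc_subset_Icc_self hr'), ENNReal.ofReal_mul (by norm_num),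
        ENNReal.ofReal_mul (Real.exp_pos _).le, h.ofReal_kk]
      simp [EE]
    · exact (intervalIntegrable_iff_integrableOn_Ioc_of_le hs).1 h2
    · exact Eventually.of_forall fun r => hf.deriv_nonneg
  have h5 : 3 * ∫⁻ r in Ioc 0 s, EE y r * N (y r) ≤ EE y s := by
    rw [← h4]
    apply ENNReal.ofReal_le_ofReal
    have : 0 < f 0 := Real.exp_pos _
    have : f s = Real.exp (3 * KK y s) := rfl
    linarith
  calc _ = 3⁻¹ * (3 * ∫⁻ r in Ioc 0 s, EE y r * N (y r)) := by
        rw [← mul_assoc, ENNReal.inv_mul_cancel (by simp) (by simp), one_mul]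
    _ ≤ _ := by gcongr

lemma Nice.EE_ne_zero (t) : EE y t ≠ 0 := by
  simp [EE, Real.exp_pos]
lemma Nice.EE_ne_top (t) : EE y t ≠ ⊤ := by simp [EE]

lemma Nice.gronwall {T : ℝ} {g : ℝ → ℝ≥0∞} {C : ℝ≥0∞} (hC : C ≠ ⊤)
    (hg : ∀ t ∈ Icc 0 T, g t ≤ C)
    (hg' : ∀ t ∈ Icc 0 T, g t ≤ 1 + ∫⁻ r in Ioc 0 t, g r * N (y r)) :
    ∀ t ∈ Icc 0 T, g t ≤ 2 * EE y t := by
  let H : ℝ≥0∞ := ⨆ t ∈ Icc 0 T, g t / EE y t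
  have hH1 : ∀ t ∈ Icc 0 T, g t ≤ H * EE y t := by
    intro t ht
    rw [← ENNReal.div_le_iff (h.EE_ne_zero t) (h.EE_ne_top t)]
    exact le_iSup₂_of_le t ht le_rfl
  have hH2 : H ≤ C := by
    refine iSup₂_le fun t ht => ?_
    rw [ENNReal.div_le_iff (h.EE_ne_zero t) (h.EE_ne_top t)]
    calc g t ≤ C * 1 := by rw [mul_one]; exact hg t ht
      _ ≤ _ := by gcongr; exact h.EE_one ht.1
  have hH3 : H ≤ 1 + 3⁻¹ * H := by
    refine iSup₂_le fun t ht => ?_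
    rw [ENNReal.div_le_iff (h.EE_ne_zero t) (h.EE_ne_top t)]
    calc g t ≤ 1 + ∫⁻ r in Ioc 0 t, g r * N (y r) := hg' t ht
      _ ≤ 1 + ∫⁻ r in Ioc 0 t, H * (EE y r * N (y r)) := by
          gcongr 1 + ?_
          refine setLIntegral_mono' measurableSet_Ioc fun r hr => ?_
          rw [← mul_assoc]
          gcongr
          exact hH1 r ⟨hr.1.le, hr.2.trans ht.2⟩
      _ = 1 + H * ∫⁻ r in Ioc 0 t, EE y r * N (y r) := by
          have hm : Measurable fun r => EE y r * N (y r) := h.EE_cont.measurable.mul h.meas.N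
          rw [lintegral_const_mul _ hm]
      _ ≤ EE y t + H * (3⁻¹ * EE y t) := by
          gcongr
          · exact h.EE_one ht.1
          · exact h.weight ht.1
      _ = _ := by ring
  have hH4 : H ≤ 2 := by
    have hHt : H ≠ ⊤ := ne_top_of_le_ne_top hC hH2
    lift H to NNReal using hHt with H'
    have : ((3⁻¹ : ℝ≥0∞)) = ((3⁻¹ : NNReal) : ℝ≥0∞) := by simp
    rw [this] at hH3
    have h3 : H' ≤ 1 + 3⁻¹ * H' := by exact_mod_cast hH3
    have h4 : (H' : ℝ) ≤ 1 + 3⁻¹ * H' := by exact_mod_cast h3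
    have h5 : (H' : ℝ) ≤ 2 := by linarith
    exact_mod_cast h5
  intro t ht
  exact (hH1 t ht).trans (by gcongr)

end

structure NDev (y μ : ℝ → TS d) : Prop where
  int : ∀ t n w, IntegrableOn (fun r => TS.mul (μ r) (y r) n w) (Ioc 0 t)
  eq : ∀ t, μ t = TS.one + Z (volume.restrict (Ioc 0 t)) fun r => TS.mul (μ r) (y r)

section
variable {y μ : ℝ → TS d} (h : Nice y) (hμ : NDev y μ)
include h hμ

lemma NDev.mul_neg (r : ℝ) (hr : r ≤ 0) (n w) : TS.mul (μ r) (y r) n w = 0 := by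
  rw [h.neg r hr]; simp [TS.mul]

lemma NDev.iint (a b : ℝ) (n w) : IntervalIntegrable (fun r => TS.mul (μ r) (y r) n w) volume a b := by
  have h1 : ∀ t : ℝ, IntegrableOn (fun r => TS.mul (μ r) (y r) n w) (Iic t) := by
    intro t
    have h3 : IntegrableOn (fun r => TS.mul (μ r) (y r) n w) (Iic 0) := by
      refine (integrableOn_zero : IntegrableOn (fun _ => (0:ℝ)) (Iic (0:ℝ)) volume).congr_fun (fun r hr => ?_) measurableSet_Iic
      exact (hμ.mul_neg h r hr n w).symm
    refine (h3.union (hμ.int t n w)).mono_set fun r hr => ?_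
    by_cases h0 : r ≤ 0
    · exact Or.inl h0
    · exact Or.inr ⟨not_le.1 h0, hr⟩
  rw [intervalIntegrable_iff]
  exact (h1 (max a b)).mono_set fun r hr => hr.2

lemma NDev.eq' (t : ℝ) (n w) :
    μ t n w = (TS.one : TS d) n w + ∫ r in (0:ℝ)..t, TS.mul (μ r) (y r) n w := by
  conv_lhs => rw [hμ.eq t]
  change _ + ∫ r in Ioc 0 t, TS.mul (μ r) (y r) n w = _
  congr 1
  rcases le_total 0 t with h0 | h0
  · rw [intervalIntegral.integral_of_le h0]
  · rw [intervalIntegral.integral_of_ge h0, Ioc_eq_empty (not_lt.2 h0)]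
    rw [setIntegral_eq_zero_of_forall_eq_zero (t := Ioc t 0) fun r hr => hμ.mul_neg h r hr.2 n w]
    simp

lemma NDev.cont (n w) : Continuous fun t => μ t n w := by
  simp_rw [hμ.eq' h]
  exact continuous_const.add (intervalIntegral.continuous_primitive (fun a b => hμ.iint h a b n w) 0)

lemma NDev.MM : MM μ := fun n w => (hμ.cont h n w).measurable

lemma NDev.bound {t : ℝ} (ht : 0 ≤ t) : N (μ t) ≤ 2 * EE y t := by
  have key : ∀ M, N (TS.truncate M (μ t)) ≤ 2 * EE y t := by
    intro M
    have hN : ∀ s, N (TS.truncate M (μ s)) = ∑ n ∈ Finset.range (M + 1), ‖lv (μ s) n‖ₑ := by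
      intro s
      rw [N, tsum_eq_sum (s := Finset.range (M + 1))]
      · refine Finset.sum_congr rfl fun n hn => ?_
        congr 1
        ext w
        have : n ≤ M := by simpa [Nat.lt_succ_iff] using hn
        simp [TS.truncate, this]
      · intro n hn
        have : ¬ n ≤ M := by simpa [Nat.lt_succ_iff] using hn
        have : lv (TS.truncate M (μ s)) n = 0 := by ext w; simp [TS.truncate, this]
        rw [this, enorm_zero]
    have hc : Continuous fun s => N (TS.truncate M (μ s)) := by
      simp_rw [hN]
      refine continuous_finsetSum _ fun n _ => ?_
      refine continuous_enorm.comp ?_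
      refine (PiLp.continuous_toLp 2 _).comp ?_
      exact continuous_pi fun w => hμ.cont h n w
    obtain ⟨s0, _, hs0⟩ := (isCompact_Icc (a := (0:ℝ)) (b := t)).exists_isMaxOn ⟨0, le_rfl, ht⟩ hc.continuousOn
    refine h.gronwall (T := t) (C := N (TS.truncate M (μ s0)))
      (g := fun s => N (TS.truncate M (μ s))) ?_ ?_ ?_ t ⟨ht, le_rfl⟩
    · rw [hN]; exact ENNReal.sum_ne_top.2 fun n _ => enorm_ne_top
    · intro s hs; exact hs0 hs
    · intro s hs
      have : TS.truncate M (μ s) = TS.truncate M TS.one +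
          Z (volume.restrict (Ioc 0 s)) fun r => TS.truncate M (TS.mul (μ r) (y r)) := by
        conv_lhs => rw [hμ.eq s]
        ext n w
        simp only [TS.truncate, Pi.add_apply, Z]
        split_ifs <;> simp
      simp only [this]
      refine (N_add_le _ _).trans (add_le_add ((N_trunc_le _ _).trans N_one.le) ?_)
      refine (N_Z_le (((hμ.MM h).mul h.meas).trunc M)).trans ?_
      exact lintegral_mono fun r => trunc_mul M _ _
  have : ∀ M, ∑ n ∈ Finset.range M, ‖lv (μ t) n‖ₑ ≤ 2 * EE y t := by
    intro M
    refine le_trans ?_ (key M)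
    refine le_trans (Finset.sum_le_sum fun n hn => ?_) (ENNReal.sum_le_tsum (Finset.range M))
    apply lv_mono
    intro w
    have : n ≤ M := by simp at hn; omega
    simp [TS.truncate, this]
  rw [N, ENNReal.tsum_eq_iSup_nat]
  exact iSup_le this

lemma NDev.eq_one {t : ℝ} (ht : t ≤ 0) : μ t = TS.one := by
  rw [hμ.eq t, Ioc_eq_empty (not_lt.2 ht)]
  ext n w; simp [Z]

lemma NDev.fin (t : ℝ) : N (μ t) ≠ ⊤ := by
  rcases le_total 0 t with h0 | h0
  · exact ne_top_of_le_ne_top (ENNReal.mul_ne_top (by simp) (h.EE_ne_top t)) (hμ.bound h h0)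
  · rw [hμ.eq_one h h0]; exact one_fin

lemma NDev.lint {s t : ℝ} :
    ∫⁻ r in Ioc s t, N (TS.mul (μ r) (y r)) ≤ 2 * EE y t * ∫⁻ r in Ioc s t, N (y r) := by
  rw [← lintegral_const_mul _ h.meas.N]
  refine setLIntegral_mono' measurableSet_Ioc fun r hr => ?_
  rcases le_total 0 r with h0 | h0
  · refine (N_mul_le _ _).trans ?_
    gcongr
    refine (hμ.bound h h0).trans ?_
    gcongr
    exact h.EE_mono hr.2
  · refine (N_mul_le _ _).trans ?_
    simp [h.neg r h0, N_zero]

lemma NDev.lint_fin {t : ℝ} : ∫⁻ r in Ioc 0 t, N (TS.mul (μ r) (y r)) ≠ ⊤ :=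
  ne_top_of_le_ne_top (ENNReal.mul_ne_top (ENNReal.mul_ne_top (by simp) (h.EE_ne_top t)) (h.int t))
    (hμ.lint h)

lemma NDev.sub_le {s t : ℝ} (hst : s ≤ t) :
    N (μ t - μ s) ≤ 2 * EE y t * ENNReal.ofReal (KK y t - KK y s) := by
  have : μ t - μ s = Z (volume.restrict (Ioc s t)) fun r => TS.mul (μ r) (y r) := by
    ext n w
    simp only [Pi.sub_apply]
    rw [hμ.eq' h, hμ.eq' h, add_sub_add_left_eq_sub,
      intervalIntegral.integral_interval_sub_left (hμ.iint h _ _ _ _) (hμ.iint h _ _ _ _),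
      intervalIntegral.integral_of_le hst]
    rfl
  rw [this, ← h.KK_sub hst]
  exact (N_Z_le ((hμ.MM h).mul h.meas)).trans (hμ.lint h)

lemma NDev.NC : NC μ := by
  intro p
  have hc : Continuous fun q => 2 * EE y (max q p) * ENNReal.ofReal |KK y q - KK y p| := by
    have h1 := h.KK_cont
    refine ENNReal.continuous_ofReal.comp (f := fun q => 2 * Real.exp (3 * KK y (max q p)) *
      |KK y q - KK y p|) (by fun_prop) |>.congr fun q => ?_
    simp only [Function.comp]
    rw [ENNReal.ofReal_mul (by positivity), ENNReal.ofReal_mul (by positivity)]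
    simp [EE]
  have := hc.tendsto p
  simp only [sub_self, abs_zero, ENNReal.ofReal_zero, mul_zero] at this
  refine tendsto_of_tendsto_of_tendsto_of_le_of_le tendsto_const_nhds this (fun _ => zero_le) ?_
  intro q
  rcases le_total p q with hpq | hpq
  · simp only [max_eq_left hpq]
    refine (hμ.sub_le h hpq).trans ?_
    gcongr
    exact le_abs_self _
  · simp only [max_eq_right hpq, abs_sub_comm (KK y q)]
    rw [N_sub_comm]
    refine (hμ.sub_le h hpq).trans ?_
    gcongr
    exact le_abs_self _

lemma NDev.L_nil (t : ℝ) : L (μ t) [] = 1 := by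
  conv_lhs => rw [hμ.eq t]
  rw [L_add, L_one]
  simp only [if_true]
  have : L (Z (volume.restrict (Ioc 0 t)) fun r => TS.mul (μ r) (y r)) [] =
    ∫ r in Ioc 0 t, L (TS.mul (μ r) (y r)) [] := rfl
  rw [this]
  simp only [L_mul]
  have : ∀ r, L (y r) [] = 0 := fun r => h.zero r _
  simp [this]

lemma NDev.pairing_eq {x : TS d} (hx : N x ≠ ⊤) (t : ℝ) : TS.pairing x (μ t) =
    L x [] + ∫ r in Ioc 0 t, TS.pairing x (TS.mul (μ r) (y r)) := by
  conv_lhs => rw [hμ.eq t]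
  have hM := (hμ.MM h).mul h.meas
  rw [pairing_add_right hx one_fin (Z_fin hM (hμ.lint_fin h)), pairing_one,
    pairing_Z hx hM (hμ.lint_fin h)]

lemma NDev.adjL_eq {x : TS d} (hx : N x ≠ ⊤) (t : ℝ) : TS.reduce (TS.adjL x (μ t)) =
    Z (volume.restrict (Ioc 0 t)) fun r => TS.reduce (TS.adjL x (TS.mul (μ r) (y r))) := by
  have hM := (hμ.MM h).mul h.meas
  have h1 : TS.reduce (TS.adjL x (μ t)) = TS.reduce (TS.adjL x (Z (volume.restrict (Ioc 0 t))
      fun r => TS.mul (μ r) (y r))) := by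
    apply L_inj
    intro l
    rw [L_reduce, L_reduce]
    split_ifs with hl
    · rfl
    · rw [L_adjL, L_adjL, hμ.eq t, sh_add]
      have : sh l (TS.one : TS d) = 0 := by
        apply L_inj; intro v; rw [sh, L_T_apply, L_one]; simp [hl]; rfl
      rw [this, zero_add]
  rw [h1, adjL_Z hx hM (hμ.lint_fin h)]
  ext n w
  simp only [TS.reduce, Z]
  split_ifs <;> simp

end

end PS
open scoped BigOperators ENNReal
open MeasureTheory

namespace PS
variable {d : ℕ}
open Filter Topology Set

noncomputable def I1 (a b : TS d) (u : ℝ) (φ φt : TS d) : ℝ :=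
  u * TS.pairing a b + TS.pairing φ (TS.reduce (TS.adjR a b))
    + TS.pairing φt (TS.reduce (TS.adjR b a))

noncomputable def I2 (a : TS d) (u : ℝ) (φ φt : TS d) : TS d :=
  TS.add (TS.add (TS.smul u a) (TS.mul φ a)) (TS.reduce (TS.adjL φt a))

noncomputable def GG (u : ℝ) (φ φt : TS d) : ℝ≥0∞ := ‖u‖ₑ + N φ + N φt

lemma I1_le {a b : TS d} (ha : N a ≠ ⊤) (hb : N b ≠ ⊤) (u : ℝ) (φ φt : TS d) :
    ‖I1 a b u φ φt‖ₑ ≤ GG u φ φt * (N a * N b) := by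
  unfold I1 GG
  refine (enorm_add_le _ _).trans ?_
  refine (add_le_add (enorm_add_le _ _) le_rfl).trans ?_
  rw [add_mul, add_mul]
  gcongr
  · rw [enorm_mul]; gcongr; exact pairing_le _ _
  · refine (pairing_le _ _).trans ?_
    gcongr
    exact (N_reduce_le _).trans (N_adjR_le ha hb)
  · refine (pairing_le _ _).trans ?_
    rw [mul_comm (N a)]
    gcongr
    exact (N_reduce_le _).trans (N_adjR_le hb ha)

lemma I2_le {a : TS d} (ha : N a ≠ ⊤) (u : ℝ) {φ φt : TS d} (hφt : N φt ≠ ⊤) :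
    N (I2 a u φ φt) ≤ GG u φ φt * N a := by
  unfold I2 GG
  refine (N_add_le _ _).trans ?_
  refine (add_le_add (N_add_le _ _) le_rfl).trans ?_
  rw [add_mul, add_mul]
  gcongr
  · exact (N_smul _ _).le
  · exact N_mul_le _ _
  · exact (N_reduce_le _).trans (N_adjL_le hφt ha)

lemma I1_sub {a b : TS d} (ha : N a ≠ ⊤) (hb : N b ≠ ⊤) (u u' : ℝ) {φ φt φ' φt' : TS d}
    (h1 : N φ ≠ ⊤) (h2 : N φt ≠ ⊤) (h1' : N φ' ≠ ⊤) (h2' : N φt' ≠ ⊤) :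
    I1 a b (u - u') (φ - φ') (φt - φt') = I1 a b u φ φt - I1 a b u' φ' φt' := by
  unfold I1
  have e1 := reduce_fin (adjR_fin ha hb)
  have e2 := reduce_fin (adjR_fin hb ha)
  rw [pairing_comm (φ - φ'), pairing_comm (φt - φt'), pairing_sub_right e1 h1 h1',
    pairing_sub_right e2 h2 h2', pairing_comm _ φ, pairing_comm _ φ', pairing_comm _ φt,
    pairing_comm _ φt']
  ring

lemma I2_sub {a : TS d} (ha : N a ≠ ⊤) (u u' : ℝ) {φ φt φ' φt' : TS d}
    (h2 : N φt ≠ ⊤) (h2' : N φt' ≠ ⊤) :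
    I2 a (u - u') (φ - φ') (φt - φt') = I2 a u φ φt - I2 a u' φ' φt' := by
  unfold I2
  rw [mul_sub_left, adjL_sub_left h2 h2' ha, reduce_sub]
  ext n w
  simp only [TS.add, TS.smul, Pi.sub_apply]
  ring

lemma MM.I1 {X : Type*} [MeasurableSpace X] {a b φ φt : X → TS d} {u : X → ℝ} (ha : MM a) (hb : MM b)
    (ha' : ∀ r, PS.N (a r) ≠ ⊤) (hb' : ∀ r, PS.N (b r) ≠ ⊤) (hu : Measurable u) (hφ : MM φ) (hφt : MM φt)
    (h1 : ∀ r, PS.N (φ r) ≠ ⊤) (h2 : ∀ r, PS.N (φt r) ≠ ⊤) :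
    Measurable fun r => I1 (a r) (b r) (u r) (φ r) (φt r) := by
  unfold PS.I1
  refine ((hu.mul (ha.pairing hb ha' hb')).add ?_).add ?_
  · exact hφ.pairing (ha.adjR hb ha' hb').reduce h1 fun r => reduce_fin (adjR_fin (ha' r) (hb' r))
  · exact hφt.pairing (hb.adjR ha hb' ha').reduce h2 fun r => reduce_fin (adjR_fin (hb' r) (ha' r))

lemma MM.I2 {X : Type*} [MeasurableSpace X] {a φ φt : X → TS d} {u : X → ℝ} (ha : MM a)
    (ha' : ∀ r, PS.N (a r) ≠ ⊤) (hu : Measurable u) (hφ : MM φ) (hφt : MM φt)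
    (h2 : ∀ r, PS.N (φt r) ≠ ⊤) :
    MM fun r => I2 (a r) (u r) (φ r) (φt r) :=
  ((MM.smul hu ha).add (hφ.mul ha)).add (hφt.adjL ha h2 ha').reduce

structure NReg (u : ℝ → ℝ → ℝ) (φ φt : ℝ → ℝ → TS d) : Prop where
  uc : Continuous fun p : ℝ × ℝ => u p.1 p.2
  φc : NC fun p : ℝ × ℝ => φ p.1 p.2
  φtc : NC fun p : ℝ × ℝ => φt p.1 p.2
  φf : ∀ s t, N (φ s t) ≠ ⊤
  φtf : ∀ s t, N (φt s t) ≠ ⊤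

lemma NC.sub {X : Type*} [TopologicalSpace X] {F G : X → TS d} (hF : NC F) (hG : NC G) :
    NC fun q => F q - G q := by
  intro p
  have := (hF p).add (hG p)
  rw [add_zero] at this
  refine tendsto_of_tendsto_of_tendsto_of_le_of_le tendsto_const_nhds this (fun _ => zero_le) ?_
  intro q
  have e : F q - G q - (F p - G p) = (F q - F p) - (G q - G p) := by abel
  simp only [e]
  exact N_sub_le _ _

lemma NReg.sub {u u' : ℝ → ℝ → ℝ} {φ φt φ' φt' : ℝ → ℝ → TS d} (h : NReg u φ φt) (h' : NReg u' φ' φt') :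
    NReg (fun s t => u s t - u' s t) (fun s t => φ s t - φ' s t) (fun s t => φt s t - φt' s t) where
  uc := h.uc.sub h'.uc
  φc := h.φc.sub h'.φc
  φtc := h.φtc.sub h'.φtc
  φf s t := sub_fin (h.φf s t) (h'.φf s t)
  φtf s t := sub_fin (h.φtf s t) (h'.φtf s t)

section
variable {y yt : ℝ → TS d} (hy : Nice y) (hyt : Nice yt)
variable {u : ℝ → ℝ → ℝ} {φ φt : ℝ → ℝ → TS d} (h : NReg u φ φt)

lemma NReg.swap (h : NReg u φ φt) :
    NReg (fun s t => u t s) (fun s t => φt t s) (fun s t => φ t s) := by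
  have hc : Continuous fun p : ℝ × ℝ => (p.2, p.1) := by fun_prop
  have h1 := h.uc.comp hc
  have h2 := NC.comp h.φtc hc
  have h3 := NC.comp h.φc hc
  exact ⟨h1, h2, h3, fun s t => h.φtf t s, fun s t => h.φf t s⟩

lemma NReg.bdd (h : NReg u φ φt) (S T : ℝ) : ∃ C : ℝ≥0∞, C ≠ ⊤ ∧ ∀ s ∈ Icc 0 S, ∀ t ∈ Icc 0 T,
    GG (u s t) (φ s t) (φt s t) ≤ C := by
  have hc : Continuous fun p : ℝ × ℝ => GG (u p.1 p.2) (φ p.1 p.2) (φt p.1 p.2) := by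
    have h1 : Continuous fun p : ℝ × ℝ => ‖u p.1 p.2‖ₑ := continuous_enorm.comp h.uc
    have h2 := NC.N_cont h.φc fun p => h.φf p.1 p.2
    have h3 := NC.N_cont h.φtc fun p => h.φtf p.1 p.2
    exact (h1.add h2).add h3
  have hK : IsCompact (Icc 0 S ×ˢ Icc 0 T : Set (ℝ × ℝ)) := isCompact_Icc.prod isCompact_Icc
  by_cases hne : (Icc 0 S ×ˢ Icc 0 T : Set (ℝ × ℝ)).Nonempty
  · obtain ⟨p, _, hp⟩ := hK.exists_isMaxOn hne hc.continuousOn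
    refine ⟨GG (u p.1 p.2) (φ p.1 p.2) (φt p.1 p.2), ?_, fun s hs t ht => ?_⟩
    swap
    · have hm : (s, t) ∈ (Icc 0 S ×ˢ Icc 0 T : Set (ℝ × ℝ)) := ⟨hs, ht⟩
      exact isMaxOn_iff.1 hp (s, t) hm
    exact ENNReal.add_ne_top.2 ⟨ENNReal.add_ne_top.2 ⟨enorm_ne_top, h.φf _ _⟩, h.φtf _ _⟩
  · refine ⟨0, by simp, fun s hs t ht => (hne ⟨(s, t), hs, ht⟩).elim⟩

include hy h
lemma NReg.I2_MM (t : ℝ) : MM fun r => I2 (y r) (u r t) (φ r t) (φt r t) := by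
  have hc : Continuous fun r : ℝ => (r, t) := by fun_prop
  exact MM.I2 hy.meas hy.fin (h.uc.comp hc).measurable (h.φc.comp hc).MM (h.φtc.comp hc).MM
    fun r => h.φtf _ _

lemma NReg.I2_int (s t : ℝ) (ht : 0 ≤ t) :
    ∫⁻ r in Ioc 0 s, N (I2 (y r) (u r t) (φ r t) (φt r t)) ≠ ⊤ := by
  obtain ⟨C, hC, hb⟩ := h.bdd s t
  refine ne_top_of_le_ne_top (ENNReal.mul_ne_top hC (hy.int s)) ?_
  rw [← lintegral_const_mul _ hy.meas.N]
  refine setLIntegral_mono' measurableSet_Ioc fun r hr => ?_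
  refine (I2_le (hy.fin r) _ (h.φtf _ _)).trans ?_
  gcongr
  exact hb r ⟨hr.1.le, hr.2⟩ t ⟨ht, le_rfl⟩

include hyt
lemma NReg.I1_meas : Measurable fun p : ℝ × ℝ =>
    I1 (y p.1) (yt p.2) (u p.1 p.2) (φ p.1 p.2) (φt p.1 p.2) :=
  MM.I1 (hy.meas.comp measurable_fst) (hyt.meas.comp measurable_snd) (fun _ => hy.fin _)
    (fun _ => hyt.fin _) h.uc.measurable h.φc.MM h.φtc.MM (fun _ => h.φf _ _) (fun _ => h.φtf _ _)

lemma NReg.I1_int (r t : ℝ) (hr : 0 ≤ r) :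
    IntegrableOn (fun v => I1 (y r) (yt v) (u r v) (φ r v) (φt r v)) (Ioc 0 t) := by
  refine ⟨((h.I1_meas hy hyt).comp measurable_prodMk_left).aestronglyMeasurable, ?_⟩
  obtain ⟨C, hC, hb⟩ := h.bdd r t
  refine (ne_top_of_le_ne_top (ENNReal.mul_ne_top (ENNReal.mul_ne_top hC (hy.fin r)) (hyt.int t)) ?_).lt_top
  rw [← lintegral_const_mul _ hyt.meas.N]
  refine setLIntegral_mono' measurableSet_Ioc fun v hv => ?_
  refine (I1_le (hy.fin r) (hyt.fin v) _ _ _).trans ?_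
  rw [← mul_assoc]
  gcongr
  exact hb r ⟨hr, le_rfl⟩ v ⟨hv.1.le, hv.2⟩

lemma NReg.I1_int2 (s t : ℝ) :
    IntegrableOn (fun r => ∫ v in Ioc 0 t, I1 (y r) (yt v) (u r v) (φ r v) (φt r v)) (Ioc 0 s) := by
  have hm := (h.I1_meas hy hyt).stronglyMeasurable
  refine ⟨(hm.integral_prod_right (ν := volume.restrict (Ioc 0 t))).aestronglyMeasurable, ?_⟩
  obtain ⟨C, hC, hb⟩ := h.bdd s t
  refine (ne_top_of_le_ne_top (ENNReal.mul_ne_top (ENNReal.mul_ne_top hC (hyt.int t)) (hy.int s)) ?_).lt_top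
  rw [← lintegral_const_mul _ hy.meas.N]
  refine setLIntegral_mono' measurableSet_Ioc fun r hr => ?_
  refine (enorm_integral_le_lintegral_enorm _).trans ?_
  rw [mul_right_comm, ← lintegral_const_mul _ hyt.meas.N]
  refine setLIntegral_mono' measurableSet_Ioc fun v hv => ?_
  refine (I1_le (hy.fin r) (hyt.fin v) _ _ _).trans ?_
  rw [← mul_assoc]
  gcongr
  exact hb r ⟨hr.1.le, hr.2⟩ v ⟨hv.1.le, hv.2⟩
end

structure NSys (c : ℝ) (y yt : ℝ → TS d) (u : ℝ → ℝ → ℝ) (φ φt : ℝ → ℝ → TS d) : Prop where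
  e1 : ∀ s t, 0 ≤ s → 0 ≤ t → u s t = c + ∫ r in Ioc 0 s, ∫ v in Ioc 0 t,
    I1 (y r) (yt v) (u r v) (φ r v) (φt r v)
  e2 : ∀ s t, 0 ≤ s → 0 ≤ t → φ s t =
    Z (volume.restrict (Ioc 0 s)) fun r => I2 (y r) (u r t) (φ r t) (φt r t)
  e3 : ∀ s t, 0 ≤ s → 0 ≤ t → φt s t =
    Z (volume.restrict (Ioc 0 t)) fun v => I2 (yt v) (u s v) (φt s v) (φ s v)

lemma Z_sub' {s : ℝ} {F G H : ℝ → TS d} (hF : MM F) (hG : MM G)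
    (hF' : ∫⁻ r in Ioc 0 s, N (F r) ≠ ⊤) (hG' : ∫⁻ r in Ioc 0 s, N (G r) ≠ ⊤)
    (hH : ∀ r ∈ Ioc 0 s, H r = F r - G r) :
    Z (volume.restrict (Ioc 0 s)) H =
      Z (volume.restrict (Ioc 0 s)) F - Z (volume.restrict (Ioc 0 s)) G := by
  ext n w
  simp only [Z, Pi.sub_apply]
  rw [← integral_sub (comp_int hF hF' n w) (comp_int hG hG' n w)]
  refine setIntegral_congr_fun measurableSet_Ioc fun r hr => ?_
  simp [hH r hr]

lemma NSys.sub {y yt : ℝ → TS d} (hy : Nice y) (hyt : Nice yt) {c : ℝ}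
    {u u' : ℝ → ℝ → ℝ} {φ φt φ' φt' : ℝ → ℝ → TS d} (hr : NReg u φ φt) (hr' : NReg u' φ' φt')
    (h : NSys c y yt u φ φt) (h' : NSys c y yt u' φ' φt') :
    NSys 0 y yt (fun s t => u s t - u' s t) (fun s t => φ s t - φ' s t)
      (fun s t => φt s t - φt' s t) where
  e1 s t hs ht := by
    rw [h.e1 s t hs ht, h'.e1 s t hs ht, add_sub_add_left_eq_sub, zero_add,
      ← integral_sub (hr.I1_int2 hy hyt s t) (hr'.I1_int2 hy hyt s t)]
    refine setIntegral_congr_fun measurableSet_Ioc fun r hrr => ?_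
    rw [← integral_sub (hr.I1_int hy hyt r t hrr.1.le) (hr'.I1_int hy hyt r t hrr.1.le)]
    refine setIntegral_congr_fun measurableSet_Ioc fun v hv => ?_
    rw [I1_sub (hy.fin r) (hyt.fin v) _ _ (hr.φf _ _) (hr.φtf _ _) (hr'.φf _ _) (hr'.φtf _ _)]
  e2 s t hs ht := by
    rw [h.e2 s t hs ht, h'.e2 s t hs ht]
    refine (Z_sub' (hr.I2_MM hy t) (hr'.I2_MM hy t) (hr.I2_int hy s t ht) (hr'.I2_int hy s t ht) ?_).symm
    intro r _
    exact I2_sub (hy.fin r) _ _ (hr.φtf _ _) (hr'.φtf _ _)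
  e3 s t hs ht := by
    rw [h.e3 s t hs ht, h'.e3 s t hs ht]
    refine (Z_sub' (hr.swap.I2_MM hyt s) (hr'.swap.I2_MM hyt s) (hr.swap.I2_int hyt t s hs)
      (hr'.swap.I2_int hyt t s hs) ?_).symm
    intro r _
    exact I2_sub (hyt.fin r) _ _ (hr.φf _ _) (hr'.φf _ _)

lemma NSys.zero {y yt : ℝ → TS d} (hy : Nice y) (hyt : Nice yt)
    {u : ℝ → ℝ → ℝ} {φ φt : ℝ → ℝ → TS d} (hr : NReg u φ φt)
    (h : NSys 0 y yt u φ φt) (s t : ℝ) (hs : 0 ≤ s) (ht : 0 ≤ t) :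
    GG (u s t) (φ s t) (φt s t) = 0 := by
  obtain ⟨C, hC, hb⟩ := hr.bdd s t
  let G : ℝ → ℝ → ℝ≥0∞ := fun s t => GG (u s t) (φ s t) (φt s t)
  let W : ℝ → ℝ → ℝ≥0∞ := fun s t => EE y s * EE yt t
  have hW0 : ∀ a b, W a b ≠ 0 := fun a b => mul_ne_zero (hy.EE_ne_zero a) (hyt.EE_ne_zero b)
  have hWt : ∀ a b, W a b ≠ ⊤ := fun a b => ENNReal.mul_ne_top (hy.EE_ne_top a) (hyt.EE_ne_top b)
  let H : ℝ≥0∞ := ⨆ a ∈ Icc 0 s, ⨆ b ∈ Icc 0 t, G a b / W a b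
  have hH1 : ∀ a ∈ Icc 0 s, ∀ b ∈ Icc 0 t, G a b ≤ H * W a b := by
    intro a ha b hb
    rw [← ENNReal.div_le_iff (hW0 a b) (hWt a b)]
    exact le_iSup₂_of_le a ha (le_iSup₂_of_le b hb le_rfl)
  have hH2 : H ≤ C := by
    refine iSup₂_le fun a ha => iSup₂_le fun b hb' => ?_
    rw [ENNReal.div_le_iff (hW0 a b) (hWt a b)]
    calc G a b ≤ C * (1 * 1) := by rw [mul_one, mul_one]; exact hb a ha b hb'
      _ ≤ _ := by
        simp only [W]
        gcongr
        · exact hy.EE_one ha.1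
        · exact hyt.EE_one hb'.1
  have hm : Measurable fun r => EE y r * N (y r) := hy.EE_cont.measurable.mul hy.meas.N
  have hmt : Measurable fun r => EE yt r * N (yt r) := hyt.EE_cont.measurable.mul hyt.meas.N
  have hH3 : H ≤ (9⁻¹ + 3⁻¹ + 3⁻¹) * H := by
    refine iSup₂_le fun a ha => iSup₂_le fun b hb' => ?_
    rw [ENNReal.div_le_iff (hW0 a b) (hWt a b)]
    have b1 : ‖u a b‖ₑ ≤ 9⁻¹ * H * W a b := by
      rw [h.e1 a b ha.1 hb'.1, zero_add]
      calc _ ≤ ∫⁻ r in Ioc 0 a, H * (3⁻¹ * EE yt b) * (EE y r * N (y r)) := by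
            refine (enorm_integral_le_lintegral_enorm _).trans ?_
            refine setLIntegral_mono' measurableSet_Ioc fun r hr => ?_
            refine (enorm_integral_le_lintegral_enorm _).trans ?_
            calc _ ≤ ∫⁻ v in Ioc 0 b, H * (EE y r * N (y r)) * (EE yt v * N (yt v)) := by
                  refine setLIntegral_mono' measurableSet_Ioc fun v hv => ?_
                  refine (I1_le (hy.fin r) (hyt.fin v) _ _ _).trans ?_
                  refine (mul_le_mul_left (hH1 r ⟨hr.1.le, hr.2.trans ha.2⟩ v ⟨hv.1.le, hv.2.trans hb'.2⟩) _).trans ?_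
                  simp only [W]
                  exact le_of_eq (by ring)
              _ = H * (EE y r * N (y r)) * ∫⁻ v in Ioc 0 b, (EE yt v * N (yt v)) :=
                  lintegral_const_mul _ hmt
              _ ≤ H * (EE y r * N (y r)) * (3⁻¹ * EE yt b) := by gcongr; exact hyt.weight hb'.1
              _ = _ := by ring
        _ = H * (3⁻¹ * EE yt b) * ∫⁻ r in Ioc 0 a, (EE y r * N (y r)) := lintegral_const_mul _ hm
        _ ≤ H * (3⁻¹ * EE yt b) * (3⁻¹ * EE y a) := by gcongr; exact hy.weight ha.1
        _ = (3⁻¹ * 3⁻¹) * H * W a b := by simp only [W]; ring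
        _ = _ := by
          rw [← ENNReal.mul_inv (by simp) (by simp)]; norm_num
    have b2 : N (φ a b) ≤ 3⁻¹ * H * W a b := by
      rw [h.e2 a b ha.1 hb'.1]
      calc _ ≤ ∫⁻ r in Ioc 0 a, H * EE yt b * (EE y r * N (y r)) := by
            refine (N_Z_le (hr.I2_MM hy b)).trans ?_
            refine setLIntegral_mono' measurableSet_Ioc fun r hrr => ?_
            refine (I2_le (hy.fin r) _ (hr.φtf _ _)).trans ?_
            refine (mul_le_mul_left (hH1 r ⟨hrr.1.le, hrr.2.trans ha.2⟩ b hb') _).trans ?_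
            simp only [W]
            exact le_of_eq (by ring)
        _ = H * EE yt b * ∫⁻ r in Ioc 0 a, (EE y r * N (y r)) := lintegral_const_mul _ hm
        _ ≤ H * EE yt b * (3⁻¹ * EE y a) := by gcongr; exact hy.weight ha.1
        _ = _ := by simp only [W]; ring
    have b3 : N (φt a b) ≤ 3⁻¹ * H * W a b := by
      rw [h.e3 a b ha.1 hb'.1]
      calc _ ≤ ∫⁻ r in Ioc 0 b, H * EE y a * (EE yt r * N (yt r)) := by
            refine (N_Z_le (hr.swap.I2_MM hyt a)).trans ?_
            refine setLIntegral_mono' measurableSet_Ioc fun r hrr => ?_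
            refine (I2_le (hyt.fin r) _ (hr.φf _ _)).trans ?_
            have : GG (u a r) (φt a r) (φ a r) = G a r := by
              simp only [G, GG]; ring
            rw [this]
            refine (mul_le_mul_left (hH1 a ha r ⟨hrr.1.le, hrr.2.trans hb'.2⟩) _).trans ?_
            simp only [W]
            exact le_of_eq (by ring)
        _ = H * EE y a * ∫⁻ r in Ioc 0 b, (EE yt r * N (yt r)) := lintegral_const_mul _ hmt
        _ ≤ H * EE y a * (3⁻¹ * EE yt b) := by gcongr; exact hyt.weight hb'.1
        _ = _ := by simp only [W]; ring
    calc G a b ≤ 9⁻¹ * H * W a b + 3⁻¹ * H * W a b + 3⁻¹ * H * W a b := add_le_add (add_le_add b1 b2) b3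
      _ = _ := by ring
  have hH4 : H = 0 := by
    have hHt : H ≠ ⊤ := ne_top_of_le_ne_top hC hH2
    lift H to NNReal using hHt with H'
    have e3 : ((3⁻¹ : ℝ≥0∞)) = ((3⁻¹ : NNReal) : ℝ≥0∞) := by simp
    have e9 : ((9⁻¹ : ℝ≥0∞)) = ((9⁻¹ : NNReal) : ℝ≥0∞) := by simp
    rw [e3, e9] at hH3
    have h3 : H' ≤ (9⁻¹ + 3⁻¹ + 3⁻¹) * H' := by exact_mod_cast hH3
    have h4 : (H' : ℝ) ≤ (9⁻¹ + 3⁻¹ + 3⁻¹) * H' := by exact_mod_cast h3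
    have h5 : (H' : ℝ) ≤ 0 := by norm_num at h4; linarith
    have h6 : H' ≤ 0 := by exact_mod_cast h5
    simpa using h6
  have := hH1 s ⟨hs, le_rfl⟩ t ⟨ht, le_rfl⟩
  rw [hH4, zero_mul] at this
  exact le_antisymm this zero_le

lemma NSys.unique {y yt : ℝ → TS d} (hy : Nice y) (hyt : Nice yt) {c : ℝ}
    {u u' : ℝ → ℝ → ℝ} {φ φt φ' φt' : ℝ → ℝ → TS d} (hr : NReg u φ φt) (hr' : NReg u' φ' φt')
    (h : NSys c y yt u φ φt) (h' : NSys c y yt u' φ' φt') (s t : ℝ) (hs : 0 ≤ s) (ht : 0 ≤ t) :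
    u s t = u' s t ∧ φ s t = φ' s t ∧ φt s t = φt' s t := by
  have := (h.sub hy hyt hr hr' h').zero hy hyt (hr.sub hr') s t hs ht
  simp only [GG, add_eq_zero] at this
  obtain ⟨⟨h1, h2⟩, h3⟩ := this
  refine ⟨sub_eq_zero.1 (by simpa using h1), sub_eq_zero.1 (eq_zero_of_N _ h2), sub_eq_zero.1 (eq_zero_of_N _ h3)⟩

lemma red_adj {y : ℝ → TS d} (hy : Nice y) (a b : TS d) (ha : N a ≠ ⊤) (hb : N b ≠ ⊤) (r : ℝ) :
    TS.reduce (TS.adjL a (TS.mul b (y r))) = I2 (y r) (TS.pairing b a) (TS.reduce (TS.adjL a b))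
      (TS.reduce (TS.adjL b a)) := by
  rw [adjL_mul' ha hb (hy.fin r), pairing_comm]
  ext n w
  by_cases hn : n = 0
  · subst hn
    simp [TS.reduce, I2, TS.add, TS.smul, TS.mul, hy.zero]
  · simp only [TS.reduce, I2, TS.add, TS.smul, hn, if_false, Pi.add_apply]
    rfl

section
variable {y yt μ μt : ℝ → TS d} (hy : Nice y) (hyt : Nice yt) (hμ : NDev y μ) (hμt : NDev yt μt)
include hy hyt hμ hμt

lemma dev_reg : NReg (fun s t => TS.pairing (μ s) (μt t))
    (fun s t => TS.reduce (TS.adjL (μt t) (μ s))) (fun s t => TS.reduce (TS.adjL (μ s) (μt t))) := by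
  have f1 := hμ.fin hy
  have f2 := hμt.fin hyt
  have c1 := (hμ.NC hy).comp (continuous_fst (X := ℝ) (Y := ℝ))
  have c2 := (hμt.NC hyt).comp (continuous_snd (X := ℝ) (Y := ℝ))
  exact { uc := c1.pairing c2 (fun _ => f1 _) (fun _ => f2 _)
          φc := (c2.adjL c1 (fun _ => f2 _) (fun _ => f1 _)).reduce
          φtc := (c1.adjL c2 (fun _ => f1 _) (fun _ => f2 _)).reduce
          φf := fun s t => reduce_fin (adjL_fin (f2 t) (f1 s))
          φtf := fun s t => reduce_fin (adjL_fin (f1 s) (f2 t)) }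

lemma dev_sys : NSys 1 y yt (fun s t => TS.pairing (μ s) (μt t))
    (fun s t => TS.reduce (TS.adjL (μt t) (μ s))) (fun s t => TS.reduce (TS.adjL (μ s) (μt t))) := by
  have f1 := hμ.fin hy
  have f2 := hμt.fin hyt
  refine ⟨fun s t hs ht => ?_, fun s t hs ht => ?_, fun s t hs ht => ?_⟩
  · rw [pairing_comm, hμ.pairing_eq hy (f2 t), hμt.L_nil hyt]
    congr 1
    refine setIntegral_congr_fun measurableSet_Ioc fun r hr => ?_
    have f3 := mul_fin (f1 r) (hy.fin r)
    have e0 : L (TS.mul (μ r) (y r)) [] = 0 := by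
      have : L (y r) [] = 0 := hy.zero r _
      simp [L_mul, this]
    rw [pairing_comm, hμt.pairing_eq hyt f3, e0, zero_add]
    refine setIntegral_congr_fun measurableSet_Ioc fun v hv => ?_
    exact pair_mul_mul (f1 r) (f2 v) (hy.fin r) (hyt.fin v)
  · rw [hμ.adjL_eq hy (f2 t)]
    congr 1
    ext1 r
    exact red_adj hy _ _ (f2 t) (f1 r) r
  · rw [hμt.adjL_eq hyt (f1 s)]
    congr 1
    ext1 v
    rw [red_adj hyt _ _ (f1 s) (f2 v) v, pairing_comm]
end
end PS
open scoped BigOperators ENNReal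
open MeasureTheory

namespace PS
variable {d : ℕ}
open Filter Topology Set

open Classical in
noncomputable def hat (y : ℝ → TS d) (r : ℝ) : TS d := if 0 < r ∧ N (y r) ≠ ⊤ then y r else 0

lemma hat_nice {y : ℝ → TS d} (hy0 : ∀ u w, y u 0 w = 0) (hm : ∀ n w, Measurable fun u => y u n w)
    (hf : ∀ t : ℝ, 0 ≤ t → ∫⁻ u in Ioc (0:ℝ) t, TS.pNorm 1 (y u) ≠ ⊤) : Nice (hat y) where
  meas n w := by
    have hN : Measurable fun r => N (y r) := MM.N hm
    have hs : MeasurableSet {r : ℝ | 0 < r ∧ N (y r) ≠ ⊤} :=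
      measurableSet_Ioi.inter (hN (measurableSet_singleton (⊤ : ℝ≥0∞)).compl)
    have h1 : (fun r => hat y r n w) =
        Set.indicator {r : ℝ | 0 < r ∧ N (y r) ≠ ⊤} fun u => y u n w := by
      ext r
      by_cases h : 0 < r ∧ N (y r) ≠ ⊤
      · rw [Set.indicator_of_mem (by exact h), hat, if_pos h]
      · rw [Set.indicator_of_notMem (by exact h), hat, if_neg h]; rfl
    rw [h1]
    exact (hm n w).indicator hs
  fin r := by
    unfold hat; split_ifs with h
    · exact h.2
    · rw [N_zero]; simp
  zero r w := by
    unfold hat; split_ifs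
    · exact hy0 r w
    · rfl
  neg r hr := by
    unfold hat; rw [if_neg fun h => not_lt.2 hr h.1]
  int t := by
    rcases le_total 0 t with h0 | h0
    · refine ne_top_of_le_ne_top (hf t h0) (lintegral_mono fun r => ?_)
      rw [pNorm_eq]; unfold hat; split_ifs
      · exact le_rfl
      · rw [N_zero]; exact zero_le
    · simp [Ioc_eq_empty (not_lt.2 h0)]

lemma hat_ae {y : ℝ → TS d} (hm : ∀ n w, Measurable fun u => y u n w)
    (hf : ∀ t : ℝ, 0 ≤ t → ∫⁻ u in Ioc (0:ℝ) t, TS.pNorm 1 (y u) ≠ ⊤) :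
    ∀ᵐ r : ℝ, 0 < r → hat y r = y r := by
  have h1 : ∀ n : ℕ, ∀ᵐ r : ℝ, r ∈ Ioc (0:ℝ) n → N (y r) < ⊤ := by
    intro n
    rw [← ae_restrict_iff' measurableSet_Ioc]
    have := hf n (Nat.cast_nonneg n)
    simp only [pNorm_eq] at this
    exact ae_lt_top (MM.N hm) this
  filter_upwards [ae_all_iff.2 h1] with r hr h0
  obtain ⟨n, hn⟩ := exists_nat_ge r
  unfold hat
  rw [if_pos ⟨h0, (hr n ⟨h0, hn⟩).ne⟩]

lemma dev_hat {y μ : ℝ → TS d} (hae : ∀ᵐ r : ℝ, 0 < r → hat y r = y r) (hμ : TS.IsDev y 0 μ) :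
    NDev (hat y) fun t => μ (max t 0) := by
  have hae' : ∀ n w, ∀ᵐ r : ℝ, 0 < r →
      TS.mul (μ (max r 0)) (hat y r) n w = TS.mul (μ r) (y r) n w := by
    intro n w
    filter_upwards [hae] with r hr h0
    rw [hr h0, max_eq_left h0.le]
  constructor
  · intro t n w
    rcases le_total 0 t with h0 | h0
    · have h1 := (intervalIntegrable_iff_integrableOn_Ioc_of_le h0).1 (hμ.1 t n w)
      refine Integrable.congr h1 ?_
      rw [Filter.EventuallyEq, ae_restrict_iff' measurableSet_Ioc]
      filter_upwards [hae' n w] with r hr h0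
      exact (hr h0.1).symm
    · simp [Ioc_eq_empty (not_lt.2 h0)]
  · intro t
    have key : ∀ t, 0 ≤ t → μ t = TS.one + Z (volume.restrict (Ioc 0 t)) fun r => TS.mul (μ (max r 0)) (hat y r) := by
      intro t h0
      ext n w
      rw [hμ.2 t h0 n w, intervalIntegral.integral_of_le h0]
      simp only [Pi.add_apply, Z]
      congr 1
      refine setIntegral_congr_ae measurableSet_Ioc ?_
      filter_upwards [hae' n w] with r hr h0
      exact (hr h0.1).symm
    rcases le_total 0 t with h0 | h0
    · simp only [max_eq_left h0]; exact key t h0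
    · simp only [max_eq_right h0]
      rw [key 0 le_rfl]
      simp [Ioc_eq_empty (not_lt.2 h0)]

def cl {A : Type*} (F : ℝ → ℝ → A) : ℝ → ℝ → A := fun s t => F (max s 0) (max t 0)

lemma cl_eq {A : Type*} (F : ℝ → ℝ → A) {s t : ℝ} (hs : 0 ≤ s) (ht : 0 ≤ t) : cl F s t = F s t := by
  simp [cl, hs, ht]

lemma sys_iff {y yt : ℝ → TS d} (hae : ∀ᵐ r : ℝ, 0 < r → hat y r = y r)
    (haet : ∀ᵐ r : ℝ, 0 < r → hat yt r = yt r) (u : ℝ → ℝ → ℝ) (φ φt : ℝ → ℝ → TS d) :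
    TS.ExtSystem y yt u φ φt ↔ NSys 1 (hat y) (hat yt) (cl u) (cl φ) (cl φt) := by
  have e1 : ∀ s t, 0 ≤ s → 0 ≤ t → (∫ r in (0:ℝ)..s, ∫ v in (0:ℝ)..t,
      I1 (y r) (yt v) (u r v) (φ r v) (φt r v)) = ∫ r in Ioc 0 s, ∫ v in Ioc 0 t,
      I1 (hat y r) (hat yt v) (cl u r v) (cl φ r v) (cl φt r v) := by
    intro s t hs ht
    rw [intervalIntegral.integral_of_le hs]
    refine setIntegral_congr_ae measurableSet_Ioc ?_
    filter_upwards [hae] with r hr h0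
    rw [intervalIntegral.integral_of_le ht]
    refine setIntegral_congr_ae measurableSet_Ioc ?_
    filter_upwards [haet] with v hv h0'
    rw [hr h0.1, hv h0'.1, cl_eq _ h0.1.le h0'.1.le, cl_eq _ h0.1.le h0'.1.le, cl_eq _ h0.1.le h0'.1.le]
  have e2 : ∀ s t, 0 ≤ s → 0 ≤ t → ∀ n w, (∫ r in (0:ℝ)..s, I2 (y r) (u r t) (φ r t) (φt r t) n w) =
      Z (volume.restrict (Ioc 0 s)) (fun r => I2 (hat y r) (cl u r t) (cl φ r t) (cl φt r t)) n w := by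
    intro s t hs ht n w
    rw [intervalIntegral.integral_of_le hs]
    refine setIntegral_congr_ae measurableSet_Ioc ?_
    filter_upwards [hae] with r hr h0
    rw [hr h0.1, cl_eq _ h0.1.le ht, cl_eq _ h0.1.le ht, cl_eq _ h0.1.le ht]
  have e3 : ∀ s t, 0 ≤ s → 0 ≤ t → ∀ n w, (∫ r in (0:ℝ)..t, I2 (yt r) (u s r) (φt s r) (φ s r) n w) =
      Z (volume.restrict (Ioc 0 t)) (fun r => I2 (hat yt r) (cl u s r) (cl φt s r) (cl φ s r)) n w := by
    intro s t hs ht n w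
    rw [intervalIntegral.integral_of_le ht]
    refine setIntegral_congr_ae measurableSet_Ioc ?_
    filter_upwards [haet] with r hr h0
    rw [hr h0.1, cl_eq _ hs h0.1.le, cl_eq _ hs h0.1.le, cl_eq _ hs h0.1.le]
  constructor
  · rintro ⟨h1, h2, h3⟩
    refine ⟨fun s t hs ht => ?_, fun s t hs ht => ?_, fun s t hs ht => ?_⟩
    · rw [cl_eq _ hs ht, ← e1 s t hs ht]; exact h1 s t hs ht
    · ext n w
      rw [cl_eq _ hs ht, ← e2 s t hs ht]; exact h2 s t hs ht n w
    · ext n w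
      rw [cl_eq _ hs ht, ← e3 s t hs ht]; exact h3 s t hs ht n w
  · rintro ⟨h1, h2, h3⟩
    refine ⟨fun s t hs ht => ?_, fun s t hs ht n w => ?_, fun s t hs ht n w => ?_⟩
    · have := h1 s t hs ht
      rw [cl_eq _ hs ht, ← e1 s t hs ht] at this; exact this
    · have := congrFun (congrFun (h2 s t hs ht) n) w
      rw [cl_eq _ hs ht, ← e2 s t hs ht] at this; exact this
    · have := congrFun (congrFun (h3 s t hs ht) n) w
      rw [cl_eq _ hs ht, ← e3 s t hs ht] at this; exact this

lemma clamp_cont : Continuous fun p : ℝ × ℝ => (max p.1 0, max p.2 0) := by fun_prop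

lemma clamp_mem (p : ℝ × ℝ) : (max p.1 0, max p.2 0) ∈ (Ici 0 ×ˢ Ici 0 : Set (ℝ × ℝ)) :=
  ⟨le_max_right p.1 0, le_max_right p.2 0⟩

lemma cont_iff (F : ℝ → ℝ → TS d) :
    TS.Cont1On F (Ici 0 ×ˢ Ici 0) ↔ NC fun p : ℝ × ℝ => cl F p.1 p.2 := by
  constructor
  · intro h p
    rw [ENNReal.tendsto_nhds_zero]
    intro ε hε
    obtain ⟨ε', hε', hlt⟩ : ∃ ε' : ℝ, 0 < ε' ∧ ENNReal.ofReal ε' ≤ ε := by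
      by_cases ht : ε = ⊤
      · exact ⟨1, one_pos, by simp [ht]⟩
      · exact ⟨ε.toReal, ENNReal.toReal_pos hε.ne' ht, ENNReal.ofReal_toReal_le⟩
    obtain ⟨δ, hδ, h1⟩ := h (max p.1 0, max p.2 0) (clamp_mem p) ε' hε'
    have := (clamp_cont.tendsto p).eventually (Metric.ball_mem_nhds _ hδ)
    filter_upwards [this] with q hq
    have h2 := h1 (max q.1 0, max q.2 0) (clamp_mem q) hq
    rw [pNorm_eq] at h2
    exact h2.le.trans hlt
  · intro h p hp ε hε
    have h1 := (h p).eventually (gt_mem_nhds (ENNReal.ofReal_pos.2 hε))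
    obtain ⟨δ, hδ, h2⟩ := Metric.eventually_nhds_iff.1 h1
    refine ⟨δ, hδ, fun q hq hqp => ?_⟩
    have h3 : N (cl F q.1 q.2 - cl F p.1 p.2) < _ := h2 hqp
    rw [cl_eq _ hq.1 hq.2, cl_eq _ hp.1 hp.2] at h3
    rw [pNorm_eq]
    exact h3

lemma reg_of {u : ℝ → ℝ → ℝ} {φ φt : ℝ → ℝ → TS d} (h : TS.ExtSystemRegular u φ φt) :
    NReg (cl u) (cl φ) (cl φt) := by
  obtain ⟨h1, h2, h3, h4⟩ := h
  refine ⟨?_, (cont_iff φ).1 h2, (cont_iff φt).1 h3, fun s t => ?_, fun s t => ?_⟩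
  · exact h1.comp_continuous clamp_cont clamp_mem
  · have := (h4 _ _ (le_max_right s 0) (le_max_right t 0)).1
    rwa [pNorm_eq] at this
  · have := (h4 _ _ (le_max_right s 0) (le_max_right t 0)).2.1
    rwa [pNorm_eq] at this

lemma reg_to {u : ℝ → ℝ → ℝ} {φ φt : ℝ → ℝ → TS d} (h : NReg (cl u) (cl φ) (cl φt))
    (h0 : ∀ s t, ∀ w : Word d 0, φ s t 0 w = 0) (h0' : ∀ s t, ∀ w : Word d 0, φt s t 0 w = 0) :
    TS.ExtSystemRegular u φ φt := by
  refine ⟨?_, (cont_iff φ).2 h.φc, (cont_iff φt).2 h.φtc, fun s t hs ht => ⟨?_, ?_, h0 s t, h0' s t⟩⟩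
  · refine h.uc.continuousOn.congr fun p hp => ?_
    exact (cl_eq _ hp.1 hp.2).symm
  · have := h.φf s t
    rwa [cl_eq _ hs ht, ← pNorm_eq] at this
  · have := h.φtf s t
    rwa [cl_eq _ hs ht, ← pNorm_eq] at this

end PS
/-- **Extended PDE system for the inner product of free developments**: let `𝔶, 𝔶̃` be
`𝒯_0`-valued, componentwise measurable with `∫_0^t ‖𝔶(u)‖_1 du < ∞` and
`∫_0^t ‖𝔶̃(u)‖_1 du < ∞` for all `t ≥ 0`, and let `μ, μ̃` be their free developments.
Then `u(s,t) = ⟨μ(s), μ̃(t)⟩`, `φ(s,t) = μ̃(t) ⊳₀ μ(s)`, `φ̃(s,t) = μ(s) ⊳₀ μ̃(t)` is the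
unique continuous `(ℝ × 𝒯^1_0 × 𝒯^1_0)`-valued solution of the coupled integral system. -/
theorem extended_pde_system (d : ℕ) (y yt : ℝ → TS d)
    (hy0 : ∀ u w, y u 0 w = 0) (hyt0 : ∀ u w, yt u 0 w = 0)
    (hymeas : ∀ n w, Measurable fun u => y u n w)
    (hytmeas : ∀ n w, Measurable fun u => yt u n w)
    (hyint : ∀ a b n w, IntervalIntegrable (fun u => y u n w) volume a b)
    (hytint : ∀ a b n w, IntervalIntegrable (fun u => yt u n w) volume a b)
    (hyfin : ∀ t : ℝ, 0 ≤ t → ∫⁻ u in Set.Ioc (0:ℝ) t, TS.pNorm 1 (y u) ≠ ⊤)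
    (hytfin : ∀ t : ℝ, 0 ≤ t → ∫⁻ u in Set.Ioc (0:ℝ) t, TS.pNorm 1 (yt u) ≠ ⊤)
    (μ μt : ℝ → TS d) (hμ : TS.IsDev y 0 μ) (hμt : TS.IsDev yt 0 μt) :
    -- the triplet built from the free developments …
    (TS.ExtSystem y yt (fun s t => TS.pairing (μ s) (μt t))
        (fun s t => TS.reduce (TS.adjL (μt t) (μ s)))
        (fun s t => TS.reduce (TS.adjL (μ s) (μt t))) ∧
      TS.ExtSystemRegular (fun s t => TS.pairing (μ s) (μt t))
        (fun s t => TS.reduce (TS.adjL (μt t) (μ s)))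
        (fun s t => TS.reduce (TS.adjL (μ s) (μt t)))) ∧
    -- … is the unique such solution
    (∀ (u : ℝ → ℝ → ℝ) (φ φt : ℝ → ℝ → TS d),
      TS.ExtSystem y yt u φ φt → TS.ExtSystemRegular u φ φt →
      ∀ s t : ℝ, 0 ≤ s → 0 ≤ t →
        u s t = TS.pairing (μ s) (μt t) ∧
        φ s t = TS.reduce (TS.adjL (μt t) (μ s)) ∧
        φt s t = TS.reduce (TS.adjL (μ s) (μt t))) := by
  have n1 := PS.hat_nice hy0 hymeas hyfin
  have n2 := PS.hat_nice hyt0 hytmeas hytfin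
  have a1 := PS.hat_ae hymeas hyfin
  have a2 := PS.hat_ae hytmeas hytfin
  have d1 := PS.dev_hat a1 hμ
  have d2 := PS.dev_hat a2 hμt
  have hs := PS.dev_sys n1 n2 d1 d2
  have hr := PS.dev_reg n1 n2 d1 d2
  refine ⟨⟨(PS.sys_iff a1 a2 _ _ _).2 hs, PS.reg_to hr ?_ ?_⟩, ?_⟩
  · intro s t w; simp [TS.reduce]
  · intro s t w; simp [TS.reduce]
  · intro u φ φt h1 h2 s t h0 h0'
    have := PS.NSys.unique n1 n2 (PS.reg_of h2) hr ((PS.sys_iff a1 a2 _ _ _).1 h1) hs s t h0 h0'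
    simpa only [PS.cl_eq _ h0 h0', max_eq_left h0, max_eq_left h0'] using this
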